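/- Let Γ be a countable discrete abelian group and A, B ⊆ Γ nonempty. Then there exists a finite-index subgroup K ≤ Γ (depending only on A and B) with the following property: for every Følner sequence Φ = (Φ_n)_{n∈ℕ} for Γ with δ := d̲_Φ(A) + d̲_Φ(B) − d̲_Φ(A+B) > 0, there exist a strictly increasing sequence of indices (n_j)_{j∈ℕ} and finite sets Ψ_j ⊆ Φ_{n_j} such that Ψ = (Ψ_j)_{j∈ℕ} is a Følner sequence for Γ satisfying: (1) liminf_{j→∞} |Ψ_j|/|Φ_{n_j}| ≥ [Γ:K]·δ; (2) the densities d_Ψ(A+B) and d_Ψ(A+B+K) both exist and are equal; (3) the densities d_Ψ(A), d_Ψ(B) and d_Ψ(A+B) all exist and d_Ψ(A) + d_Ψ(B) − d_Ψ(A+B) ≥ δ. -/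

import Mathlib

open scoped Pointwise
open Filter

namespace SumsetMeans

variable (Γ : Type*) [AddCommGroup Γ] [Countable Γ]

/-- The density of `C` in the finite set `F n`, i.e. `|C ∩ F n| / |F n|`. -/
noncomputable def dens (F : ℕ → Finset Γ) (C : Set Γ) (n : ℕ) : ℝ :=
  ((C ∩ (F n : Set Γ)).ncard : ℝ) / ((F n).card : ℝ)

/-- A Følner sequence for `Γ`: nonempty finite sets asymptotically invariant under
every translation. -/
def IsFolnerSeq (F : ℕ → Finset Γ) : Prop :=
  (∀ n, (F n).Nonempty) ∧
  ∀ t : Γ, Tendsto (fun n =>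
      ((symmDiff ((F n : Set Γ)) ((F n : Set Γ) + ({t} : Set Γ))).ncard : ℝ) / ((F n).card : ℝ))
    atTop (nhds 0)

section InvariantMeans

variable {G : Type*}

/-- A real function with bounded range. -/
def Bdd (f : G → ℝ) : Prop := ∃ C, ∀ x, |f x| ≤ C

@[simp] lemma Bdd.const (c : ℝ) : Bdd (fun _ : G => c) := ⟨|c|, fun _ => le_rfl⟩

lemma Bdd.add {f g : G → ℝ} (hf : Bdd f) (hg : Bdd g) : Bdd (fun x => f x + g x) := by
  obtain ⟨C, hC⟩ := hf
  obtain ⟨D, hD⟩ := hg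
  exact ⟨C + D, fun x => (abs_add_le _ _).trans (add_le_add (hC x) (hD x))⟩

lemma Bdd.mul {f g : G → ℝ} (hf : Bdd f) (hg : Bdd g) : Bdd (fun x => f x * g x) := by
  obtain ⟨C, hC⟩ := hf
  obtain ⟨D, hD⟩ := hg
  refine ⟨C * D, fun x => ?_⟩
  rw [abs_mul]
  exact mul_le_mul (hC x) (hD x) (abs_nonneg _) ((abs_nonneg _).trans (hC x))

lemma Bdd.neg {f : G → ℝ} (hf : Bdd f) : Bdd (fun x => -f x) := by
  obtain ⟨C, hC⟩ := hf
  exact ⟨C, fun x => by rw [abs_neg]; exact hC x⟩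

lemma Bdd.sub {f g : G → ℝ} (hf : Bdd f) (hg : Bdd g) : Bdd (fun x => f x - g x) := by
  simpa only [sub_eq_add_neg] using hf.add hg.neg

lemma Bdd.comp {H : Type*} {f : G → ℝ} (hf : Bdd f) (u : H → G) : Bdd (fun x => f (u x)) := by
  obtain ⟨C, hC⟩ := hf
  exact ⟨C, fun x => hC _⟩

lemma Bdd.abs {f : G → ℝ} (hf : Bdd f) : Bdd (fun x => |f x|) := by
  obtain ⟨C, hC⟩ := hf
  exact ⟨C, fun x => by rw [abs_abs]; exact hC x⟩

lemma Bdd.sum {ι : Type*} (s : Finset ι) {f : ι → G → ℝ} (hf : ∀ i ∈ s, Bdd (f i)) :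
    Bdd (fun x => ∑ i ∈ s, f i x) := by
  classical
  induction s using Finset.induction_on with
  | empty => simp
  | insert a s ha ih =>
    simp only [Finset.sum_insert ha]
    exact (hf a (by simp)).add (ih fun i hi => hf i (by simp [hi]))

/-- The real indicator function of a set. -/
noncomputable def ind (S : Set G) : G → ℝ := S.indicator (fun _ => 1)

lemma ind_of_mem {S : Set G} {x : G} (h : x ∈ S) : ind S x = 1 := Set.indicator_of_mem h _

lemma ind_of_notMem {S : Set G} {x : G} (h : x ∉ S) : ind S x = 0 :=
  Set.indicator_of_notMem h _

lemma ind_nonneg (S : Set G) (x : G) : 0 ≤ ind S x := by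
  by_cases h : x ∈ S <;> simp [ind, h]

lemma ind_le_one (S : Set G) (x : G) : ind S x ≤ 1 := by
  by_cases h : x ∈ S <;> simp [ind, h]

lemma ind_abs (S : Set G) (x : G) : |ind S x| = ind S x := abs_of_nonneg (ind_nonneg S x)

lemma ind_univ : ind (Set.univ : Set G) = fun _ => 1 := by
  funext x; simp [ind]

lemma ind_mono {S T : Set G} (h : S ⊆ T) (x : G) : ind S x ≤ ind T x := by
  by_cases hx : x ∈ S
  · rw [ind_of_mem hx, ind_of_mem (h hx)]
  · rw [ind_of_notMem hx]; exact ind_nonneg T x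

lemma ind_inter (S T : Set G) (x : G) : ind (S ∩ T) x = ind S x * ind T x := by
  by_cases hx : x ∈ S <;> by_cases hy : x ∈ T <;> simp [ind, hx, hy]

@[simp] lemma Bdd.ind (S : Set G) : Bdd (ind S) :=
  ⟨1, fun x => by rw [ind_abs]; exact ind_le_one S x⟩

variable [AddCommGroup G]

/-- A translation-invariant mean on bounded functions (with value `0` at unbounded functions). -/
structure IsMean (φ : (G → ℝ) → ℝ) : Prop where
  add : ∀ {f g : G → ℝ}, Bdd f → Bdd g → φ (fun x => f x + g x) = φ f + φ g
  smul : ∀ (c : ℝ) {f : G → ℝ}, Bdd f → φ (fun x => c * f x) = c * φ f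
  nonneg : ∀ {f : G → ℝ}, Bdd f → (∀ x, 0 ≤ f x) → 0 ≤ φ f
  one : φ (fun _ => 1) = 1
  shift : ∀ (t : G) {f : G → ℝ}, Bdd f → φ (fun x => f (x + t)) = φ f
  junk : ∀ {f : G → ℝ}, ¬ Bdd f → φ f = 0

variable (G) in
/-- The convex compact set of invariant means. -/
def meanSet : Set ((G → ℝ) → ℝ) := {φ | IsMean φ}

/-- Ergodic means are the extreme points of the set of invariant means. -/
def IsErgodic (φ : (G → ℝ) → ℝ) : Prop := φ ∈ (meanSet G).extremePoints ℝ

lemma IsErgodic.isMean {φ : (G → ℝ) → ℝ} (h : IsErgodic φ) : IsMean φ := h.1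

namespace IsMean

variable {φ : (G → ℝ) → ℝ} (hφ : IsMean φ)
include hφ

lemma const (c : ℝ) : φ (fun _ => c) = c := by
  have := hφ.smul c (Bdd.const (G := G) 1)
  simpa [hφ.one] using this

lemma neg {f : G → ℝ} (hf : Bdd f) : φ (fun x => -f x) = -φ f := by
  have := hφ.smul (-1) hf
  simpa using this

lemma sub {f g : G → ℝ} (hf : Bdd f) (hg : Bdd g) : φ (fun x => f x - g x) = φ f - φ g := by
  simp only [sub_eq_add_neg]
  rw [hφ.add hf hg.neg, hφ.neg hg]

lemma mono {f g : G → ℝ} (hf : Bdd f) (hg : Bdd g) (h : ∀ x, f x ≤ g x) : φ f ≤ φ g := by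
  have := hφ.nonneg (hg.sub hf) (fun x => sub_nonneg.2 (h x))
  rw [hφ.sub hg hf] at this
  linarith

lemma le_const {f : G → ℝ} (hf : Bdd f) {c : ℝ} (h : ∀ x, f x ≤ c) : φ f ≤ c := by
  rw [← hφ.const c]; exact hφ.mono hf (by simp) h

lemma const_le {f : G → ℝ} (hf : Bdd f) {c : ℝ} (h : ∀ x, c ≤ f x) : c ≤ φ f := by
  rw [← hφ.const c]; exact hφ.mono (by simp) hf h

lemma abs_le {f : G → ℝ} {c : ℝ} (h : ∀ x, |f x| ≤ c) : |φ f| ≤ c :=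
  _root_.abs_le.2 ⟨hφ.const_le ⟨c, h⟩ fun x => (_root_.abs_le.1 (h x)).1,
    hφ.le_const ⟨c, h⟩ fun x => (_root_.abs_le.1 (h x)).2⟩

lemma sum {ι : Type*} (s : Finset ι) {f : ι → G → ℝ} (hf : ∀ i ∈ s, Bdd (f i)) :
    φ (fun x => ∑ i ∈ s, f i x) = ∑ i ∈ s, φ (f i) := by
  classical
  induction s using Finset.induction_on with
  | empty => simpa using hφ.const 0
  | insert a s ha ih =>
    simp only [Finset.sum_insert ha]
    rw [hφ.add (hf a (by simp)) (Bdd.sum s fun i hi => hf i (by simp [hi])),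
      ih fun i hi => hf i (by simp [hi])]

lemma bdd_inner {F : G → G → ℝ} {c : ℝ} (h : ∀ e x, |F e x| ≤ c) : Bdd (fun e => φ (F e)) :=
  ⟨c, fun e => hφ.abs_le (h e)⟩

lemma ind_nonneg (S : Set G) : 0 ≤ φ (ind S) := hφ.nonneg (by simp) (SumsetMeans.ind_nonneg S)

lemma ind_mono {S T : Set G} (h : S ⊆ T) : φ (ind S) ≤ φ (ind T) :=
  hφ.mono (by simp) (by simp) (SumsetMeans.ind_mono h)

lemma ind_le_one (S : Set G) : φ (ind S) ≤ 1 := hφ.le_const (by simp) (SumsetMeans.ind_le_one S)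

lemma ind_diff_add_inter (S T : Set G) : φ (ind S) = φ (ind (S \ T)) + φ (ind (S ∩ T)) := by
  rw [← hφ.add (by simp) (by simp)]
  congr 1; funext x
  by_cases hx : x ∈ S <;> by_cases hy : x ∈ T <;> simp [ind, hx, hy]

lemma ind_union_le (S T : Set G) : φ (ind (S ∪ T)) ≤ φ (ind S) + φ (ind T) := by
  rw [← hφ.add (by simp) (by simp)]
  refine hφ.mono (by simp) (Bdd.add (by simp) (by simp)) fun x => ?_
  by_cases hx : x ∈ S <;> by_cases hy : x ∈ T <;> simp [ind, hx, hy]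

lemma ind_union_add_inter (S T : Set G) :
    φ (ind (S ∪ T)) + φ (ind (S ∩ T)) = φ (ind S) + φ (ind T) := by
  rw [← hφ.add (by simp) (by simp), ← hφ.add (by simp) (by simp)]
  congr 1; funext x
  by_cases hx : x ∈ S <;> by_cases hy : x ∈ T <;> simp [ind, hx, hy]

lemma ind_preimage_add (S : Set G) (t : G) : φ (ind ((fun x => x + t) ⁻¹' S)) = φ (ind S) := by
  rw [← hφ.shift t (Bdd.ind S)]
  rfl

lemma ind_diff_of_subset {S T : Set G} (h : T ⊆ S) :
    φ (ind (S \ T)) = φ (ind S) - φ (ind T) := by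
  have := hφ.ind_diff_add_inter S T
  rw [Set.inter_eq_right.2 h] at this
  linarith

lemma ind_union_null {S T : Set G} (hS : φ (ind S) = 0) (hT : φ (ind T) = 0) :
    φ (ind (S ∪ T)) = 0 :=
  le_antisymm ((hφ.ind_union_le S T).trans (by rw [hS, hT, add_zero])) (hφ.ind_nonneg _)

lemma ind_null_mono {S T : Set G} (h : S ⊆ T) (hT : φ (ind T) = 0) : φ (ind S) = 0 :=
  le_antisymm (hT ▸ hφ.ind_mono h) (hφ.ind_nonneg _)

lemma ind_biUnion_null {ι : Type*} (s : Set ι) (hs : s.Finite) {S : ι → Set G}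
    (h : ∀ i ∈ s, φ (ind (S i)) = 0) : φ (ind (⋃ i ∈ s, S i)) = 0 := by
  induction s, hs using Set.Finite.induction_on with
  | empty =>
    have : (ind (∅ : Set G)) = fun _ => (0 : ℝ) := by funext x; simp [ind]
    simp [this, hφ.const]
  | insert ha hs ih =>
    rw [Set.biUnion_insert]
    exact hφ.ind_union_null (h _ (by simp)) (ih fun i hi => h i (by simp [hi]))

end IsMean

lemma meanSet_convex : Convex ℝ (meanSet G) := by
  intro φ hφ ψ hψ a b ha hb hab
  refine ⟨fun hf hg => ?_, fun c f hf => ?_, fun hf h => ?_, ?_, fun t f hf => ?_, fun hf => ?_⟩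
  all_goals simp only [Pi.add_apply, Pi.smul_apply, smul_eq_mul]
  · rw [hφ.add hf hg, hψ.add hf hg]; ring
  · rw [hφ.smul c hf, hψ.smul c hf]; ring
  · exact add_nonneg (mul_nonneg ha (hφ.nonneg hf h)) (mul_nonneg hb (hψ.nonneg hf h))
  · rw [hφ.one, hψ.one]; linarith
  · rw [hφ.shift t hf, hψ.shift t hf]
  · rw [hφ.junk hf, hψ.junk hf]; simp

lemma meanSet_isClosed : IsClosed (meanSet G) := by
  have : meanSet G =
      (⋂ (f : G → ℝ) (g : G → ℝ) (_ : Bdd f) (_ : Bdd g),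
        {φ | φ (fun x => f x + g x) = φ f + φ g}) ∩
      (⋂ (c : ℝ) (f : G → ℝ) (_ : Bdd f), {φ | φ (fun x => c * f x) = c * φ f}) ∩
      (⋂ (f : G → ℝ) (_ : Bdd f) (_ : ∀ x, 0 ≤ f x), {φ | 0 ≤ φ f}) ∩
      {φ | φ (fun _ => 1) = 1} ∩
      (⋂ (t : G) (f : G → ℝ) (_ : Bdd f), {φ | φ (fun x => f (x + t)) = φ f}) ∩
      (⋂ (f : G → ℝ) (_ : ¬ Bdd f), {φ | φ f = 0}) := by
    ext φ
    simp only [Set.mem_inter_iff, Set.mem_iInter, Set.mem_ofPred_eq]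
    constructor
    · intro h
      exact ⟨⟨⟨⟨⟨fun f g hf hg => h.add hf hg, fun c f hf => h.smul c hf⟩,
        fun f hf h0 => h.nonneg hf h0⟩, h.one⟩, fun t f hf => h.shift t hf⟩,
        fun f hf => h.junk hf⟩
    · rintro ⟨⟨⟨⟨⟨h1, h2⟩, h3⟩, h4⟩, h5⟩, h6⟩
      exact ⟨fun hf hg => h1 _ _ hf hg, fun c _ hf => h2 c _ hf, fun hf h => h3 _ hf h, h4,
        fun t _ hf => h5 t _ hf, fun hf => h6 _ hf⟩
  rw [this]
  refine IsClosed.inter (IsClosed.inter (IsClosed.inter (IsClosed.inter (IsClosed.inter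
    ?_ ?_) ?_) ?_) ?_) ?_
  · exact isClosed_iInter fun f => isClosed_iInter fun g => isClosed_iInter fun _ =>
      isClosed_iInter fun _ => isClosed_eq (continuous_apply _)
        (Continuous.add (f := fun φ : (G → ℝ) → ℝ => φ f) (g := fun φ : (G → ℝ) → ℝ => φ g)
          (continuous_apply f) (continuous_apply g))
  · exact isClosed_iInter fun c => isClosed_iInter fun f => isClosed_iInter fun _ =>
      isClosed_eq (continuous_apply _) (continuous_const.mul (continuous_apply _))
  · exact isClosed_iInter fun f => isClosed_iInter fun _ => isClosed_iInter fun _ =>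
      isClosed_le continuous_const (continuous_apply _)
  · exact isClosed_eq (continuous_apply _) continuous_const
  · exact isClosed_iInter fun c => isClosed_iInter fun f => isClosed_iInter fun _ =>
      isClosed_eq (continuous_apply _) (continuous_apply _)
  · exact isClosed_iInter fun f => isClosed_iInter fun _ =>
      isClosed_eq (continuous_apply _) continuous_const

lemma meanSet_isCompact : IsCompact (meanSet G) := by
  classical
  let b : (G → ℝ) → ℝ := fun f => if h : Bdd f then h.choose else 0
  refine (isCompact_univ_pi fun f : G → ℝ =>
    (isCompact_Icc : IsCompact (Set.Icc (-b f) (b f)))).of_isClosed_subset meanSet_isClosed ?_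
  intro φ hφ f _
  by_cases h : Bdd f
  · have := IsMean.abs_le hφ h.choose_spec
    simpa [b, h] using abs_le.1 this
  · simp [b, h, IsMean.junk hφ h]

/-- A bound valid for all ergodic means is valid for all invariant means. -/
lemma IsMean.le_of_ergodic {φ : (G → ℝ) → ℝ} (hφ : IsMean φ) {f : G → ℝ} {c : ℝ}
    (h : ∀ ψ : (G → ℝ) → ℝ, IsErgodic ψ → ψ f ≤ c) : φ f ≤ c := by
  have hK := closure_convexHull_extremePoints (meanSet_isCompact (G := G)) meanSet_convex
  have hφ' : φ ∈ meanSet G := hφ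
  rw [← hK] at hφ'
  have hcl : IsClosed {ψ : (G → ℝ) → ℝ | ψ f ≤ c} :=
    isClosed_le (continuous_apply f) continuous_const
  have hcv : Convex ℝ {ψ : (G → ℝ) → ℝ | ψ f ≤ c} :=
    convex_halfSpace_le (f := fun ψ : (G → ℝ) → ℝ => ψ f) ⟨fun _ _ => rfl, fun _ _ => rfl⟩ c
  exact closure_minimal (convexHull_min (fun ψ hψ => h ψ hψ) hcv) hcl hφ'

/-- The mean ergodic theorem for ergodic means. -/
lemma IsErgodic.fubini {φ : (G → ℝ) → ℝ} (hE : IsErgodic φ) {f h : G → ℝ}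
    (hf0 : ∀ x, 0 ≤ f x) (hf1 : ∀ x, f x ≤ 1) (hh : Bdd h) :
    φ (fun e => φ (fun x => f x * h (x + e))) = φ f * φ h := by
  classical
  have hφ := hE.isMean
  have hf : Bdd f := ⟨1, fun x => by rw [abs_of_nonneg (hf0 x)]; exact hf1 x⟩
  let ν : (G → ℝ) → ℝ := fun h => if Bdd h then φ (fun e => φ (fun x => f x * h (x + e))) else 0
  have hν : ∀ {h}, Bdd h → ν h = φ (fun e => φ (fun x => f x * h (x + e))) := fun hh => if_pos hh
  have hin : ∀ {h : G → ℝ}, Bdd h → ∀ e, Bdd (fun x => f x * h (x + e)) := fun hh e =>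
    hf.mul (hh.comp _)
  have hout : ∀ {h : G → ℝ}, Bdd h → Bdd (fun e => φ (fun x => f x * h (x + e))) := by
    rintro h ⟨C, hC⟩
    refine hφ.bdd_inner (c := C) fun e x => ?_
    rw [abs_mul, abs_of_nonneg (hf0 x)]
    exact (mul_le_of_le_one_left (abs_nonneg _) (hf1 x)).trans (hC _)
  have hadd : ∀ {g h : G → ℝ}, Bdd g → Bdd h → ν (fun x => g x + h x) = ν g + ν h := by
    intro g h hg hh
    rw [hν hg, hν hh, hν (hg.add hh), ← hφ.add (hout hg) (hout hh)]
    congr 1; funext e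
    rw [← hφ.add (hin hg e) (hin hh e)]
    congr 1; funext x; ring
  have hsmul : ∀ (c : ℝ) {h : G → ℝ}, Bdd h → ν (fun x => c * h x) = c * ν h := by
    intro c h hh
    rw [hν hh, hν ((Bdd.const c).mul hh), ← hφ.smul c (hout hh)]
    congr 1; funext e
    rw [← hφ.smul c (hin hh e)]
    congr 1; funext x; ring
  have hpos : ∀ {h : G → ℝ}, Bdd h → (∀ x, 0 ≤ h x) → 0 ≤ ν h := by
    intro h hh h0
    rw [hν hh]
    exact hφ.nonneg (hout hh) fun e => hφ.nonneg (hin hh e) fun x => mul_nonneg (hf0 x) (h0 _)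
  have hle : ∀ {h : G → ℝ}, Bdd h → (∀ x, 0 ≤ h x) → ν h ≤ φ h := by
    intro h hh h0
    rw [hν hh]
    refine hφ.le_const (hout hh) fun e => ?_
    rw [← hφ.shift e hh]
    exact hφ.mono (hin hh e) (hh.comp _) fun x => mul_le_of_le_one_left (h0 _) (hf1 x)
  have hone : ν (fun _ => 1) = φ f := by
    rw [hν (by simp)]
    simp [hφ.const]
  have hshift : ∀ (t : G) {h : G → ℝ}, Bdd h → ν (fun x => h (x + t)) = ν h := by
    intro t h hh
    rw [hν hh, hν (hh.comp _), ← hφ.shift t (hout hh)]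
    congr 1; funext e; congr 1; funext x; congr 2; abel
  have hc0 : 0 ≤ φ f := hφ.nonneg hf hf0
  have hc1 : φ f ≤ 1 := hφ.le_const hf hf1
  have h1 : IsMean (fun g => (1 - φ f) * φ g + ν g) := by
    refine ⟨fun hf hg => ?_, fun c f hf => ?_, fun hf h => ?_, ?_, fun t f hf => ?_,
      fun hf => ?_⟩
    · simp only [hφ.add hf hg, hadd hf hg]; ring
    · simp only [hφ.smul c hf, hsmul c hf]; ring
    · exact add_nonneg (mul_nonneg (by linarith) (hφ.nonneg hf h)) (hpos hf h)
    · simp only [hφ.one, hone]; ring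
    · simp only [hφ.shift t hf, hshift t hf]
    · simp [hφ.junk hf, ν, hf]
  have h2 : IsMean (fun g => (1 + φ f) * φ g - ν g) := by
    refine ⟨fun hf hg => ?_, fun c f hf => ?_, fun hf h => ?_, ?_, fun t f hf => ?_,
      fun hf => ?_⟩
    · simp only [hφ.add hf hg, hadd hf hg]; ring
    · simp only [hφ.smul c hf, hsmul c hf]; ring
    · have := hle hf h
      have := mul_nonneg hc0 (hφ.nonneg hf h)
      linarith
    · simp only [hφ.one, hone]; ring
    · simp only [hφ.shift t hf, hshift t hf]
    · simp [hφ.junk hf, ν, hf]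
  have key := hE.2 h1 h2 ⟨1 / 2, 1 / 2, by norm_num, by norm_num, by norm_num, by
    funext g; simp only [Pi.add_apply, Pi.smul_apply, smul_eq_mul]; ring⟩
  have := congrFun key h
  rw [← hν hh]
  linarith

end InvariantMeans

section AlmostPeriods

variable {G : Type*} [AddCommGroup G]

/-- The mean of the symmetric difference of `A` with its translate by `-t`. -/
noncomputable def defect (φ : (G → ℝ) → ℝ) (A : Set G) (t : G) : ℝ :=
  φ (fun x => |ind A x - ind A (x + t)|)

/-- The mean of the intersection of `B` with its translate by `-t`. -/
noncomputable def overlap (φ : (G → ℝ) → ℝ) (B : Set G) (t : G) : ℝ :=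
  φ (fun x => ind B x * ind B (x + t))

lemma bdd_ind_shift (A : Set G) (t : G) : Bdd (fun x => ind A (x + t)) := (Bdd.ind A).comp _

lemma bdd_defect (A : Set G) (t : G) : Bdd (fun x => |ind A x - ind A (x + t)|) :=
  ((Bdd.ind A).sub (bdd_ind_shift A t)).abs

lemma bdd_overlap (B : Set G) (t : G) : Bdd (fun x => ind B x * ind B (x + t)) :=
  (Bdd.ind B).mul (bdd_ind_shift B t)

namespace IsMean

variable {φ : (G → ℝ) → ℝ} (hφ : IsMean φ)
include hφ

lemma defect_zero (A : Set G) : defect φ A 0 = 0 := by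
  simp [defect, hφ.const]

lemma defect_neg (A : Set G) (t : G) : defect φ A (-t) = defect φ A t := by
  unfold defect
  rw [← hφ.shift t (bdd_defect A (-t))]
  congr 1; funext x
  rw [abs_sub_comm, add_neg_cancel_right]

lemma defect_add_le (A : Set G) (s t : G) :
    defect φ A (s + t) ≤ defect φ A s + defect φ A t := by
  unfold defect
  rw [← hφ.shift s (bdd_defect A t), ← hφ.add (bdd_defect A s) ((bdd_defect A t).comp _)]
  refine hφ.mono (bdd_defect _ _) ((bdd_defect A s).add ((bdd_defect A t).comp _)) fun x => ?_
  rw [add_assoc x s t]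
  exact abs_sub_le _ _ _

lemma overlap_shift (B : Set G) (s t : G) :
    φ (fun x => ind B (x + s) * ind B (x + t)) = overlap φ B (t - s) := by
  unfold overlap
  rw [← hφ.shift s (bdd_overlap B (t - s))]
  congr 1; funext x; congr 2; abel

lemma overlap_le (B : Set G) (t : G) : overlap φ B t ≤ φ (ind B) :=
  hφ.mono (bdd_overlap B t) (by simp) fun x =>
    mul_le_of_le_one_right (SumsetMeans.ind_nonneg _ _) (SumsetMeans.ind_le_one _ _)

/-- A set of positive mean has few pairwise almost disjoint translates. -/
lemma not_separated (B : Set G) {n : ℕ} {θ : ℝ} (hn : 2 ≤ n * φ (ind B))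
    (hθ : (n : ℝ) ^ 2 * θ ≤ 1) (h0 : 0 ≤ θ) (s : Fin n → G)
    (hs : ∀ i j, i ≠ j → overlap φ B (s i - s j) ≤ θ) : False := by
  have hb : ∀ i, Bdd (fun x => ind B (x + s i)) := fun i => bdd_ind_shift B _
  have hbb : ∀ i j, Bdd (fun x => ind B (x + s i) * ind B (x + s j)) := fun i j =>
    (hb i).mul (hb j)
  have hN : Bdd (fun x => ∑ i, ind B (x + s i)) := Bdd.sum _ fun i _ => hb i
  have hφN : φ (fun x => ∑ i, ind B (x + s i)) = n * φ (ind B) := by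
    rw [hφ.sum _ fun i _ => hb i]
    simp [hφ.shift _ (Bdd.ind B)]
  have hφN2 : φ (fun x => (∑ i, ind B (x + s i)) * ∑ i, ind B (x + s i)) ≤
      n * φ (ind B) + (n : ℝ) ^ 2 * θ := by
    simp only [Finset.sum_mul_sum]
    rw [hφ.sum _ fun i _ => Bdd.sum _ fun j _ => hbb i j]
    calc _ ≤ ∑ i : Fin n, (φ (ind B) + n * θ) := by
          refine Finset.sum_le_sum fun i _ => ?_
          rw [hφ.sum _ fun j _ => hbb i j]
          calc _ ≤ ∑ j : Fin n, ((if j = i then φ (ind B) else 0) + θ) := by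
                refine Finset.sum_le_sum fun j _ => ?_
                rw [hφ.overlap_shift]
                split_ifs with hij
                · exact (hφ.overlap_le B _).trans (by linarith)
                · rw [zero_add]; exact hs _ _ hij
            _ = _ := by simp [Finset.sum_add_distrib]
      _ = _ := by simp; ring
  have key : 0 ≤ φ (fun x => ((∑ i, ind B (x + s i)) * (∑ i, ind B (x + s i)) + 4) -
      4 * ∑ i, ind B (x + s i)) := by
    refine hφ.nonneg (((hN.mul hN).add (by simp)).sub ((Bdd.const 4).mul hN)) fun x => ?_
    nlinarith [sq_nonneg ((∑ i, ind B (x + s i)) - 2)]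
  rw [hφ.sub ((hN.mul hN).add (by simp)) ((Bdd.const 4).mul hN), hφ.add (hN.mul hN) (by simp),
    hφ.smul 4 hN, hφ.const, hφN] at key
  linarith

/-- Approximate periods form a finite-index subgroup at a suitable scale. -/
lemma exists_subgroup (A B : Set G) {n : ℕ} {θ : ℝ} (hn : 2 ≤ n * φ (ind B))
    (hθ : (n : ℝ) ^ 2 * θ ≤ 1) (h0 : 0 < θ)
    (hAB : ∀ t, θ < overlap φ B t → defect φ A t ≤ θ) :
    ∃ η : ℝ, θ ≤ η ∧ η ≤ 4 ^ n * θ ∧ ∃ H : AddSubgroup G, (∀ t, t ∈ H ↔ defect φ A t ≤ η) ∧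
      H.FiniteIndex ∧ H.index ≤ n := by
  have hsep : ∀ s : Fin n → G, ¬ ∀ i j, i ≠ j → θ < defect φ A (s i - s j) := by
    intro s hs
    refine hφ.not_separated B hn hθ h0.le s fun i j hij => ?_
    by_contra hc
    exact absurd (hAB _ (not_le.1 hc)) (not_le.2 (hs i j hij))
  have hgap : ∃ k : Fin n, ∀ t, defect φ A t ≤ 2 * (4 ^ (k : ℕ) * θ) →
      defect φ A t ≤ 4 ^ (k : ℕ) * θ := by
    by_contra hc
    push Not at hc
    choose t ht1 ht2 using hc
    have hlt : ∀ i j : Fin n, j < i → θ < defect φ A (t i - t j) := by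
      intro i j hij
      have h1 := hφ.defect_add_le A (t i - t j) (t j)
      rw [sub_add_cancel] at h1
      have h2 : (4 : ℝ) ^ ((j : ℕ) + 1) ≤ 4 ^ (i : ℕ) :=
        pow_le_pow_right₀ (by norm_num) hij
      have h3 : (1 : ℝ) ≤ 4 ^ (j : ℕ) := one_le_pow₀ (by norm_num)
      rw [pow_succ] at h2
      have h4 := ht1 j
      have h5 := ht2 i
      nlinarith
    refine hsep t fun i j hij => ?_
    rcases lt_or_gt_of_ne hij with h | h
    · rw [← hφ.defect_neg, neg_sub]; exact hlt _ _ h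
    · exact hlt _ _ h
  obtain ⟨k, hk⟩ := hgap
  have h1k : (1 : ℝ) ≤ 4 ^ (k : ℕ) := one_le_pow₀ (by norm_num)
  have hη : θ ≤ 4 ^ (k : ℕ) * θ := le_mul_of_one_le_left h0.le h1k
  refine ⟨4 ^ (k : ℕ) * θ, hη,
    mul_le_mul_of_nonneg_right (pow_le_pow_right₀ (by norm_num) k.2.le) h0.le, ?_⟩
  let H : AddSubgroup G :=
    { carrier := {t | defect φ A t ≤ 4 ^ (k : ℕ) * θ}
      zero_mem' := by
        change defect φ A 0 ≤ _
        rw [hφ.defect_zero]; linarith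
      add_mem' := by
        intro s t hs ht
        change defect φ A s ≤ _ at hs
        change defect φ A t ≤ _ at ht
        exact hk _ ((hφ.defect_add_le A s t).trans (by linarith))
      neg_mem' := by
        intro t ht
        change defect φ A (-t) ≤ _
        rw [hφ.defect_neg]; exact ht }
  have hH : ∀ t, t ∈ H ↔ defect φ A t ≤ 4 ^ (k : ℕ) * θ := fun t => Iff.rfl
  have hemb : ¬ Nonempty (Fin n ↪ G ⧸ H) := by
    rintro ⟨f⟩
    refine hsep (fun i => (f i).out) fun i j hij => ?_
    refine hη.trans_lt (not_le.1 fun hc => hij (f.injective ?_))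
    have hm : (f j).out - (f i).out ∈ H := by
      rw [← neg_sub]; exact H.neg_mem ((hH _).2 hc)
    rw [sub_eq_neg_add] at hm
    have := QuotientAddGroup.eq.2 hm
    simpa using this
  have hfin : Finite (G ⧸ H) := by
    by_contra hinf
    rw [not_finite_iff_infinite] at hinf
    exact hemb ⟨Fin.valEmbedding.trans (Infinite.natEmbedding _)⟩
  have : Fintype (G ⧸ H) := Fintype.ofFinite _
  refine ⟨H, hH, AddSubgroup.finiteIndex_of_finite_quotient, ?_⟩
  by_contra hc
  rw [AddSubgroup.index, Nat.card_eq_fintype_card, not_le] at hc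
  exact hemb (Function.Embedding.nonempty_of_card_le (by simpa using hc.le))

end IsMean

/-- If `B + a` is almost contained in `A` for every `a ∈ A`, then a translation which does not
move `B` away from itself almost preserves `A`. -/
lemma IsErgodic.overlap_mul_defect_le {φ : (G → ℝ) → ℝ} (hE : IsErgodic φ) {A B : Set G} {ε : ℝ}
    (hε : 0 ≤ ε) (h : ∀ a ∈ A, φ (ind (B \ {x | x + a ∈ A})) ≤ ε) (t : G) :
    overlap φ B t * defect φ A t ≤ 4 * ε := by
  have hφ := hE.isMean
  let v : G → G → ℝ := fun e x => ind B x * |ind A e - ind A (x + e)|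
  have hv1 : ∀ e x, |v e x| ≤ 1 := by
    intro e x
    simp only [v]
    by_cases h1 : x ∈ B <;> by_cases h2 : e ∈ A <;> by_cases h3 : x + e ∈ A <;>
      simp [ind, h1, h2, h3]
  have hvb : ∀ e, Bdd (v e) := fun e => ⟨1, hv1 e⟩
  let f : G → ℝ := fun e => φ (fun x => ind B x * ind A (x + e))
  have hf1 : ∀ e, Bdd (fun x => ind B x * ind A (x + e)) := fun e =>
    (Bdd.ind B).mul (bdd_ind_shift A e)
  have hfb : Bdd f := by
    refine hφ.bdd_inner (c := 1) fun e x => ?_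
    by_cases h1 : x ∈ B <;> by_cases h3 : x + e ∈ A <;> simp [ind, h1, h3]
  have hff : φ f = φ (ind B) * φ (ind A) :=
    hE.fubini (ind_nonneg B) (ind_le_one B) (Bdd.ind A)
  have hu : ∀ e, φ (v e) ≤ f e - (φ (ind B) - 2 * ε) * ind A e := by
    intro e
    by_cases he : e ∈ A
    · have h1 := h e he
      have h2 : φ (ind B) = φ (ind (B \ {x | x + e ∈ A})) + f e := by
        rw [hφ.ind_diff_add_inter B {x | x + e ∈ A}]
        congr 2; funext x
        rw [ind_inter]; rfl
      have h3 : φ (v e) = φ (ind (B \ {x | x + e ∈ A})) := by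
        congr 1; funext x
        by_cases h1 : x ∈ B <;> by_cases h3 : x + e ∈ A <;> simp [v, ind, h1, h3, he]
      rw [ind_of_mem he, h3]; linarith
    · have h3 : φ (v e) = f e := by
        congr 1; funext x
        by_cases h1 : x ∈ B <;> by_cases h3 : x + e ∈ A <;> simp [v, ind, h1, h3, he]
      rw [ind_of_notMem he, h3]; linarith
  have hub : Bdd (fun e => φ (v e)) := hφ.bdd_inner hv1
  have hφu : φ (fun e => φ (v e)) ≤ 2 * ε := by
    have h1 := hφ.mono hub (hfb.sub ((Bdd.const _).mul (Bdd.ind A))) hu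
    rw [hφ.sub hfb ((Bdd.const _).mul (Bdd.ind A)), hφ.smul _ (Bdd.ind A), hff] at h1
    have := hφ.ind_le_one A
    have := hφ.ind_nonneg A
    nlinarith
  have h1 : overlap φ B t * defect φ A t = φ (fun e => φ (fun x =>
      (ind B x * ind B (x + t)) * |ind A (x + e) - ind A (x + e + t)|)) := by
    unfold overlap defect
    rw [hE.fubini _ _ (bdd_defect A t)]
    · intro x; exact mul_nonneg (ind_nonneg _ _) (ind_nonneg _ _)
    · intro x; exact mul_le_one₀ (ind_le_one _ _) (ind_nonneg _ _) (ind_le_one _ _)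
  rw [h1]
  have hin : ∀ e x, |((ind B x * ind B (x + t)) * (|ind A (x + e) - ind A (x + e + t)|))| ≤ 1 := by
    intro e x
    by_cases h1 : x ∈ B <;> by_cases h2 : x + t ∈ B <;> by_cases h3 : x + e ∈ A <;>
      by_cases h4 : x + e + t ∈ A <;> simp [ind, h1, h2, h3, h4]
  have h2 : ∀ e, φ (fun x => (ind B x * ind B (x + t)) * |ind A (x + e) - ind A (x + e + t)|) ≤
      2 * φ (v e) := by
    intro e
    have h3 : φ (fun x => v e x + v e (x + t)) = 2 * φ (v e) := by
      rw [hφ.add (hvb e) ((hvb e).comp _), hφ.shift t (hvb e)]; ring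
    rw [← h3]
    refine hφ.mono ⟨1, hin e⟩ ((hvb e).add ((hvb e).comp _)) fun x => ?_
    simp only [v]
    rw [add_right_comm x t e]
    by_cases h1 : x ∈ B <;> by_cases h2 : x + t ∈ B <;> by_cases h3 : x + e ∈ A <;>
      by_cases h4 : x + e + t ∈ A <;> by_cases h5 : e ∈ A <;> simp [ind, h1, h2, h3, h4, h5]
  calc _ ≤ φ (fun e => 2 * φ (v e)) := hφ.mono (hφ.bdd_inner hin) ((Bdd.const 2).mul hub) h2
    _ = 2 * φ (fun e => φ (v e)) := hφ.smul 2 hub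
    _ ≤ _ := by linarith

/-- Dyson's transform, iterated until the second set almost cannot shrink any more. -/
lemma IsMean.exists_dyson {φ : (G → ℝ) → ℝ} (hφ : IsMean φ) {A B : Set G} {a₀ b₀ : G}
    (ha₀ : a₀ ∈ A) (hb₀ : b₀ ∈ B) {ε : ℝ} (hε : 0 < ε) :
    ∃ A' B' : Set G, a₀ ∈ A' ∧ b₀ ∈ B' ∧ A' + B' ⊆ A + B ∧
      φ (ind A') + φ (ind B') = φ (ind A) + φ (ind B) ∧
      φ (ind A) + φ (ind B) - φ (ind (A + B)) ≤ φ (ind B') ∧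
      ∀ a ∈ A', φ (ind (B' \ {x | x + (a - b₀) ∈ A'})) ≤ ε := by
  let F : Set (Set G × Set G) := {p | a₀ ∈ p.1 ∧ b₀ ∈ p.2 ∧ p.1 + p.2 ⊆ A + B ∧
      φ (ind p.1) + φ (ind p.2) = φ (ind A) + φ (ind B)}
  have hF : (A, B) ∈ F := ⟨ha₀, hb₀, subset_rfl, rfl⟩
  have hbd : BddBelow ((fun p : Set G × Set G => φ (ind p.2)) '' F) :=
    ⟨0, by rintro _ ⟨p, _, rfl⟩; exact hφ.ind_nonneg _⟩
  obtain ⟨_, ⟨⟨A', B'⟩, ⟨h1, h2, h3, h4⟩, rfl⟩, hlt⟩ :=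
    Real.lt_sInf_add_pos (s := (fun p : Set G × Set G => φ (ind p.2)) '' F) ⟨_, _, hF, rfl⟩ hε
  simp only at h1 h2 h3 h4 hlt
  refine ⟨A', B', h1, h2, h3, h4, ?_, fun a ha => ?_⟩
  · have : φ (ind A') ≤ φ (ind (A + B)) := by
      rw [← hφ.ind_preimage_add (A + B) b₀]
      exact hφ.ind_mono fun x hx => h3 (Set.add_mem_add hx h2)
    linarith
  · set e := a - b₀ with he
    have hmem : (A' ∪ {x | x - e ∈ B'}, B' ∩ {x | x + e ∈ A'}) ∈ F := by
      refine ⟨Or.inl h1, ⟨h2, by simpa [he] using ha⟩, ?_, ?_⟩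
      · rintro _ ⟨x, hx, y, ⟨hy1, hy2⟩, rfl⟩
        rcases hx with hx | hx
        · exact h3 (Set.add_mem_add hx hy1)
        · have := h3 (Set.add_mem_add hy2 hx)
          simpa [add_comm, add_left_comm] using this
      · have h5 := hφ.ind_union_add_inter A' {x | x - e ∈ B'}
        have h6 : φ (ind (B' ∩ {x | x + e ∈ A'})) = φ (ind (A' ∩ {x | x - e ∈ B'})) := by
          rw [← hφ.ind_preimage_add (A' ∩ {x | x - e ∈ B'}) e]
          congr 2
          ext x
          simp [and_comm]
        have h7 : φ (ind {x | x - e ∈ B'}) = φ (ind B') := by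
          rw [← hφ.ind_preimage_add {x | x - e ∈ B'} e]
          congr 2
          ext x
          simp
        simp only
        rw [h6, h5, h7, h4]
    have h5 := csInf_le hbd ⟨_, hmem, rfl⟩
    have h6 := hφ.ind_diff_add_inter B' {x | x + e ∈ A'}
    simp only at h5
    linarith

end AlmostPeriods

section Cosets

variable {G : Type*} [AddCommGroup G]

/-- A coset of `H` as a subset of `G`. -/
def coset (H : AddSubgroup G) (q : G ⧸ H) : Set G := {x | (x : G ⧸ H) = q}

lemma mem_coset {H : AddSubgroup G} {q : G ⧸ H} {x : G} : x ∈ coset H q ↔ (x : G ⧸ H) = q :=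
  Iff.rfl

namespace IsMean

variable {φ : (G → ℝ) → ℝ} (hφ : IsMean φ)
include hφ

lemma sum_coset (H : AddSubgroup G) [Fintype (G ⧸ H)] (S : Set G) :
    ∑ q : G ⧸ H, φ (ind (S ∩ coset H q)) = φ (ind S) := by
  classical
  rw [← hφ.sum _ fun _ _ => Bdd.ind _]
  congr 1; funext x
  rw [Finset.sum_eq_single (x : G ⧸ H)]
  · by_cases hx : x ∈ S <;> simp [ind, hx, coset]
  · intro q _ hq
    exact ind_of_notMem fun h => hq h.2.symm
  · simp

lemma coset_eq (H : AddSubgroup G) (q r : G ⧸ H) :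
    φ (ind (coset H q)) = φ (ind (coset H r)) := by
  induction q using QuotientAddGroup.induction_on with | _ x
  induction r using QuotientAddGroup.induction_on with | _ y
  rw [← hφ.ind_preimage_add (coset H x) (x - y)]
  congr 2
  ext z
  simp only [Set.mem_preimage, mem_coset, QuotientAddGroup.mk_add, QuotientAddGroup.mk_sub]
  rw [add_sub_left_comm, add_eq_left, sub_eq_zero]

lemma coset_mass (H : AddSubgroup G) [H.FiniteIndex] (q : G ⧸ H) :
    φ (ind (coset H q)) = 1 / H.index := by
  have : Fintype (G ⧸ H) := Fintype.ofFinite _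
  have h := hφ.sum_coset H Set.univ
  simp only [Set.univ_inter, ind_univ, hφ.one] at h
  rw [Finset.sum_congr rfl fun r _ => hφ.coset_eq H r q] at h
  simp only [Finset.sum_const, Finset.card_univ, nsmul_eq_mul] at h
  rw [AddSubgroup.index, Nat.card_eq_fintype_card]
  exact eq_one_div_of_mul_eq_one_right h

/-- The mean of a periodic set is computed in the quotient. -/
lemma preimage_mass (H : AddSubgroup G) [H.FiniteIndex] (Q : Set (G ⧸ H)) :
    φ (ind ((fun x : G => (x : G ⧸ H)) ⁻¹' Q)) = Q.ncard / H.index := by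
  classical
  have : Fintype (G ⧸ H) := Fintype.ofFinite _
  rw [← hφ.sum_coset H]
  have h : ∀ q : G ⧸ H, φ (ind ((fun x : G => (x : G ⧸ H)) ⁻¹' Q ∩ coset H q)) =
      if q ∈ Q then 1 / (H.index : ℝ) else 0 := by
    intro q
    split_ifs with hq
    · rw [← hφ.coset_mass H q]
      congr 2
      ext x
      simp only [Set.mem_inter_iff, Set.mem_preimage, mem_coset, and_iff_right_iff_imp]
      rintro rfl; exact hq
    · rw [← hφ.const 0]
      congr 1; funext x
      refine ind_of_notMem ?_
      rintro ⟨h1, h2⟩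
      rw [mem_coset] at h2
      exact hq (h2 ▸ h1)
  simp only [h]
  rw [← Finset.sum_filter, Finset.sum_const, nsmul_eq_mul, Set.ncard_eq_toFinset_card']
  rw [mul_one_div]
  congr 3
  ext q; simp

end IsMean

namespace IsErgodic

variable {φ : (G → ℝ) → ℝ} (hE : IsErgodic φ)
include hE

/-- If no pair `x ∈ S`, `x + e ∈ T` contributes more than `c`, then `S`, `T` have small product. -/
lemma mul_le_of_forall (S T : Set G) {c : ℝ}
    (h : ∀ e, φ (fun x => ind S x * ind T (x + e)) ≤ c) : φ (ind S) * φ (ind T) ≤ c := by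
  have hφ := hE.isMean
  rw [← hE.fubini (ind_nonneg S) (ind_le_one S) (Bdd.ind T)]
  refine hφ.le_const (hφ.bdd_inner (c := 1) fun e x => ?_) h
  by_cases h1 : x ∈ S <;> by_cases h3 : x + e ∈ T <;> simp [ind, h1, h3]

lemma zero_one_coset {A : Set G} {H : AddSubgroup G} [H.FiniteIndex] {η : ℝ} (hη : 0 ≤ η)
    (hA : ∀ t ∈ H, defect φ A t ≤ η) (q : G ⧸ H) :
    φ (ind (A ∩ coset H q)) * (1 / H.index - φ (ind (A ∩ coset H q))) ≤ η := by
  have hφ := hE.isMean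
  have h1 : (1 / (H.index : ℝ)) - φ (ind (A ∩ coset H q)) = φ (ind (coset H q \ A)) := by
    rw [← hφ.coset_mass H q, hφ.ind_diff_add_inter (coset H q) A, Set.inter_comm A]; ring
  rw [h1]
  refine hE.mul_le_of_forall _ _ fun e => ?_
  by_cases he : e ∈ H
  · refine le_trans (hφ.mono ((Bdd.ind _).mul (bdd_ind_shift _ _)) (bdd_defect A e) fun x => ?_)
      (hA e he)
    by_cases h1 : x ∈ A <;> by_cases h2 : x + e ∈ A <;> by_cases h3 : x ∈ coset H q <;>
      by_cases h4 : x + e ∈ coset H q <;> simp [ind, h1, h2, h3, h4]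
  · refine hφ.le_const ((Bdd.ind _).mul (bdd_ind_shift _ _)) fun x => ?_
    by_cases h3 : x ∈ coset H q
    · have h4 : x + e ∉ coset H q := by
        intro h4
        rw [mem_coset] at h3 h4
        rw [QuotientAddGroup.mk_add, h3, add_eq_left] at h4
        exact he ((QuotientAddGroup.eq_zero_iff e).1 h4)
      simp [ind, h4, hη]
    · simp [ind, h3, hη]

lemma concentrated {B : Set G} {H : AddSubgroup G} {θ : ℝ} (hθ : 0 ≤ θ)
    (hB : ∀ t ∉ H, overlap φ B t ≤ θ) (q : G ⧸ H) :
    φ (ind (B \ coset H q)) * φ (ind (B ∩ coset H q)) ≤ θ := by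
  have hφ := hE.isMean
  refine hE.mul_le_of_forall _ _ fun e => ?_
  by_cases he : e ∈ H
  · refine hφ.le_const ((Bdd.ind _).mul (bdd_ind_shift _ _)) fun x => ?_
    by_cases h3 : x ∈ coset H q
    · simp [ind, h3, hθ]
    · have h4 : x + e ∉ coset H q := by
        intro h4
        rw [mem_coset] at h3 h4
        rw [QuotientAddGroup.mk_add, (QuotientAddGroup.eq_zero_iff e).2 he, add_zero] at h4
        exact h3 h4
      simp [ind, h4, hθ]
  · refine le_trans (hφ.mono ((Bdd.ind _).mul (bdd_ind_shift _ _)) (bdd_overlap B e) fun x => ?_)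
      (hB e he)
    by_cases h1 : x ∈ B <;> by_cases h2 : x + e ∈ B <;> by_cases h3 : x ∈ coset H q <;>
      by_cases h4 : x + e ∈ coset H q <;> simp [ind, h1, h2, h3, h4]

/-- If `A` nearly fills the coset `q` and `B` has larger mean in the coset `z` than what `A`
misses, then `A + B` fills the coset `q + z` up to a null set. -/
lemma fill {A B : Set G} {H : AddSubgroup G} {q z : G ⧸ H}
    (h : φ (ind (coset H q \ A)) < φ (ind (B ∩ coset H z))) :
    φ (ind (coset H (q + z) \ (A + B))) = 0 := by
  have hφ := hE.isMean
  set X := coset H (q + z) \ (A + B) with hX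
  set E := coset H q \ A with hEq
  have h1 : φ (ind (B ∩ coset H z)) * φ (ind X) ≤ φ (ind E) * φ (ind X) := by
    have hin : ∀ e, Bdd (fun x => ind E x * ind X (x + e)) := fun e =>
      (Bdd.ind _).mul (bdd_ind_shift _ _)
    rw [← hE.fubini (ind_nonneg E) (ind_le_one E) (Bdd.ind X), mul_comm, ← hφ.smul _ (Bdd.ind _)]
    refine hφ.mono ((Bdd.const _).mul (Bdd.ind _)) (hφ.bdd_inner (c := 1) fun e x => ?_)
      fun e => ?_
    · by_cases h1 : x ∈ E <;> by_cases h3 : x + e ∈ X <;> simp [ind, h1, h3]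
    · by_cases he : e ∈ B ∩ coset H z
      · rw [ind_of_mem he, mul_one, ← hφ.shift e (Bdd.ind X)]
        refine hφ.mono (bdd_ind_shift _ _) (hin e) fun x => ?_
        by_cases h3 : x + e ∈ X
        · have h4 : x ∈ E := by
            refine ⟨?_, fun hA => h3.2 (Set.add_mem_add hA he.1)⟩
            have h5 := h3.1
            have h6 := he.2
            rw [mem_coset] at h5 h6 ⊢
            rw [QuotientAddGroup.mk_add, h6] at h5
            exact add_right_cancel h5
          simp [ind, h3, h4]
        · simp [ind, h3]
      · rw [ind_of_notMem he, mul_zero]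
        exact hφ.nonneg (hin e) fun x => mul_nonneg (ind_nonneg _ _) (ind_nonneg _ _)
  have h0 := hφ.ind_nonneg X
  nlinarith

/-- Coset structure of a pair `A`, `B` such that `B + a` is almost contained in `A` for all
`a ∈ A`. -/
lemma exists_structure {δ s : ℝ} (hδ : 0 < δ) (hs : 0 < s) :
    ∃ ε > 0, ∀ A B : Set G, δ ≤ φ (ind B) → (∀ a ∈ A, φ (ind (B \ {x | x + a ∈ A})) ≤ ε) →
      ∃ H : AddSubgroup G, H.FiniteIndex ∧ ∃ z : G ⧸ H,
        φ (ind B) - s ≤ φ (ind (B ∩ coset H z)) ∧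
        ∀ a ∈ A, (A ∩ coset H (a + z)).Nonempty ∧
          φ (ind (coset H (a + z) \ A)) < φ (ind (B ∩ coset H z)) := by
  have hφ := hE.isMean
  obtain ⟨n, hn⟩ := exists_nat_gt (2 / δ)
  have hn0 : (0 : ℝ) < n := lt_trans (by positivity) hn
  rw [div_lt_iff₀ hδ] at hn
  set κ : ℝ := δ / (2 * n) with hκ
  have hκ0 : 0 < κ := by positivity
  have hκn : δ / n = 2 * κ := by rw [hκ]; field_simp
  obtain ⟨θ, hθ0, hθ1, hθ2, hθ3, hθ4, hθ5⟩ : ∃ θ : ℝ, 0 < θ ∧ (n : ℝ) ^ 2 * θ ≤ 1 ∧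
      4 ^ n * θ ≤ κ ^ 2 ∧ θ ≤ s * (2 * κ) ∧ θ ≤ 1 ∧ θ ≤ κ := by
    refine ⟨min (1 / (n : ℝ) ^ 2) (min (κ ^ 2 / 4 ^ n) (min (s * (2 * κ)) (min 1 κ))),
      by positivity, ?_, ?_, ?_, ?_, ?_⟩
    · rw [← le_div_iff₀' (by positivity)]; exact min_le_left _ _
    · rw [← le_div_iff₀' (by positivity)]; exact (min_le_right _ _).trans (min_le_left _ _)
    · exact (min_le_right _ _).trans ((min_le_right _ _).trans (min_le_left _ _))
    · exact (min_le_right _ _).trans ((min_le_right _ _).trans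
        ((min_le_right _ _).trans (min_le_left _ _)))
    · exact (min_le_right _ _).trans ((min_le_right _ _).trans
        ((min_le_right _ _).trans (min_le_right _ _)))
  refine ⟨θ ^ 2 / 4, by positivity, fun A B hB hAB => ?_⟩
  have hprod : ∀ t, overlap φ B t * defect φ A t ≤ θ ^ 2 := by
    intro t
    have := hE.overlap_mul_defect_le (by positivity) hAB t
    linarith
  have hod : ∀ t, θ < overlap φ B t → defect φ A t ≤ θ := by
    intro t ht
    by_contra hc
    have := hprod t
    nlinarith
  obtain ⟨η, hη1, hη2, H, hH, hHf, hHn⟩ := hφ.exists_subgroup A B (n := n) (θ := θ)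
    (by nlinarith) hθ1 hθ0 hod
  have : Fintype (G ⧸ H) := Fintype.ofFinite _
  have hidx : (0 : ℝ) < H.index := by
    exact_mod_cast Nat.pos_of_ne_zero AddSubgroup.FiniteIndex.index_ne_zero
  have hHn' : (H.index : ℝ) ≤ n := by exact_mod_cast hHn
  have hoH : ∀ t ∉ H, overlap φ B t ≤ θ := by
    intro t ht
    by_contra hc
    exact ht ((hH t).2 ((hod t (not_le.1 hc)).trans hη1))
  obtain ⟨z, hz⟩ : ∃ z : G ⧸ H, 2 * κ ≤ φ (ind (B ∩ coset H z)) := by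
    by_contra hc
    push Not at hc
    have h1 := hφ.sum_coset H B
    have h2 : ∑ q : G ⧸ H, φ (ind (B ∩ coset H q)) < ∑ q : G ⧸ H, 2 * κ :=
      Finset.sum_lt_sum_of_nonempty Finset.univ_nonempty fun q _ => hc q
    rw [h1, Finset.sum_const, Finset.card_univ, nsmul_eq_mul, ← Nat.card_eq_fintype_card] at h2
    change _ < (H.index : ℝ) * (2 * κ) at h2
    have h3 : (H.index : ℝ) * (2 * κ) ≤ n * (2 * κ) := by gcongr
    rw [← hκn, mul_div_cancel₀ _ hn0.ne', hκn] at h3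
    linarith
  refine ⟨H, hHf, z, ?_, fun a ha => ?_⟩
  · have h1 := hE.concentrated hθ0.le hoH z
    have h2 := hφ.ind_diff_add_inter B (coset H z)
    have h3 := hφ.ind_nonneg (B \ coset H z)
    nlinarith
  · have h1 : κ ≤ φ (ind (A ∩ coset H (a + z))) := by
      have h2 : φ (ind (B ∩ coset H z)) ≤ φ (ind (B \ {x | x + a ∈ A})) +
          φ (ind (A ∩ coset H (a + z))) := by
        rw [← hφ.ind_preimage_add (A ∩ coset H (a + z)) a]
        refine le_trans (hφ.ind_mono ?_) (hφ.ind_union_le _ _)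
        rintro x ⟨hx, hxz⟩
        by_cases hxa : x + a ∈ A
        · right
          refine ⟨hxa, ?_⟩
          rw [mem_coset] at hxz ⊢
          rw [QuotientAddGroup.mk_add, hxz, add_comm]
        · exact Or.inl ⟨hx, hxa⟩
      have h3 := hAB a ha
      nlinarith
    refine ⟨?_, ?_⟩
    · by_contra hne
      rw [Set.not_nonempty_iff_eq_empty] at hne
      have : ind (∅ : Set G) = fun _ => 0 := by funext x; simp [ind]
      rw [hne, this, hφ.const] at h1
      linarith
    · have h2 := hE.zero_one_coset (hθ0.le.trans hη1) (fun t ht => (hH t).1 ht) ((a : G ⧸ H) + z)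
      have h3 := hφ.ind_diff_add_inter (coset H ((a : G ⧸ H) + z)) A
      rw [hφ.coset_mass, Set.inter_comm] at h3
      nlinarith

/-- Every element of `A + B` is contained in a large periodic set which is, up to a null set,
contained in `A + B`. -/
lemma exists_periodic {A B : Set G} (hAB : φ (ind (A + B)) < φ (ind A) + φ (ind B)) {s : ℝ}
    (hs : 0 < s) {c : G} (hc : c ∈ A + B) :
    ∃ H : AddSubgroup G, H.FiniteIndex ∧ ∃ P : Set G, (∀ x ∈ P, ∀ h ∈ H, x + h ∈ P) ∧ c ∈ P ∧
      φ (ind (P \ (A + B))) = 0 ∧ φ (ind A) + φ (ind B) - s ≤ φ (ind P) + 1 / H.index := by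
  have hφ := hE.isMean
  obtain ⟨a₀, ha₀, b₀, hb₀, rfl⟩ := hc
  obtain ⟨ε, hε, hst⟩ := hE.exists_structure (sub_pos.2 hAB) hs
  obtain ⟨A', B', ha, hb, hsub, hsum, hge, hcl⟩ := hφ.exists_dyson ha₀ hb₀ hε
  set B₀ : Set G := {x | x + b₀ ∈ B'} with hB₀
  have hB₀m : φ (ind B₀) = φ (ind B') := hφ.ind_preimage_add B' b₀
  obtain ⟨H, hH, z, hz, hfull⟩ := hst A' B₀ (by rw [hB₀m]; exact hge) (by
    intro a ha
    refine le_of_eq_of_le ?_ (hcl a ha)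
    rw [← hφ.ind_preimage_add (B' \ {x | x + (a - b₀) ∈ A'}) b₀]
    congr 2
    ext x
    simp [hB₀])
  have : Fintype (G ⧸ H) := Fintype.ofFinite _
  set Q : Set (G ⧸ H) := (fun x : G => (x : G ⧸ H)) '' A' with hQ
  have hQz : (fun q => q + z) '' Q = Q := by
    refine Set.eq_of_subset_of_ncard_le ?_ ?_
    · rintro _ ⟨_, ⟨a, ha, rfl⟩, rfl⟩
      obtain ⟨x, hx, hxz⟩ := (hfull a ha).1
      exact ⟨x, hx, hxz⟩
    · rw [Set.ncard_image_of_injective _ (add_left_injective z)]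
  have hnull : φ (ind ((fun x : G => (x : G ⧸ H)) ⁻¹' Q \ (A' + B₀))) = 0 := by
    refine hφ.ind_null_mono (T := ⋃ q ∈ Q, coset H q \ (A' + B₀)) ?_ ?_
    · rintro x ⟨hx, hx'⟩
      exact Set.mem_biUnion hx ⟨rfl, hx'⟩
    · refine hφ.ind_biUnion_null Q (Set.toFinite Q) fun q hq => ?_
      rw [← hQz] at hq
      obtain ⟨r, hr, rfl⟩ := hq
      rw [← hQz] at hr
      obtain ⟨_, ⟨a, ha, rfl⟩, rfl⟩ := hr
      exact hE.fill (hfull a ha).2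
  refine ⟨H, hH, {x | ((x - b₀ : G) : G ⧸ H) ∈ Q}, ?_, ?_, ?_, ?_⟩
  · intro x hx h hh
    have : ((x + h - b₀ : G) : G ⧸ H) = ((x - b₀ : G) : G ⧸ H) := by
      rw [add_sub_right_comm, QuotientAddGroup.mk_add, (QuotientAddGroup.eq_zero_iff h).2 hh,
        add_zero]
    rw [Set.mem_ofPred_eq, this]
    exact hx
  · exact ⟨a₀, ha, by simp⟩
  · rw [← hφ.ind_preimage_add _ b₀]
    refine hφ.ind_null_mono ?_ hnull
    rintro x ⟨hx, hx'⟩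
    refine ⟨by simpa using hx, fun h => hx' (hsub ?_)⟩
    obtain ⟨a, ha, b, hb, rfl⟩ := h
    exact ⟨a, ha, b + b₀, hb, (add_assoc _ _ _).symm⟩
  · have h1 : φ (ind A') ≤ φ (ind {x | ((x - b₀ : G) : G ⧸ H) ∈ Q}) := by
      rw [← hφ.ind_preimage_add {x | ((x - b₀ : G) : G ⧸ H) ∈ Q} b₀]
      exact hφ.ind_mono fun x hx => ⟨x, hx, by simp⟩
    have h2 : φ (ind (B₀ ∩ coset H z)) ≤ 1 / H.index :=
      (hφ.ind_mono Set.inter_subset_right).trans_eq (hφ.coset_mass H z)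
    linarith

end IsErgodic

end Cosets

section Periodic

variable {G : Type*} [AddCommGroup G]

/-- A set that is a union of cosets of `H`. -/
def IsPeriodic (H : AddSubgroup G) (P : Set G) : Prop := ∀ x ∈ P, ∀ h ∈ H, x + h ∈ P

namespace IsPeriodic

variable {H K : AddSubgroup G} {P Q : Set G}

lemma add_mem_iff (hP : IsPeriodic H P) {x h : G} (hh : h ∈ H) : x + h ∈ P ↔ x ∈ P :=
  ⟨fun hx => by simpa using hP _ hx _ (H.neg_mem hh), fun hx => hP x hx h hh⟩

lemma mono (hP : IsPeriodic H P) (hK : K ≤ H) : IsPeriodic K P :=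
  fun x hx h hh => hP x hx h (hK hh)

lemma diff (hP : IsPeriodic H P) (hQ : IsPeriodic H Q) : IsPeriodic H (P \ Q) :=
  fun x hx h hh => ⟨hP x hx.1 h hh, fun h' => hx.2 ((hQ.add_mem_iff hh).1 h')⟩

lemma union (hP : IsPeriodic H P) (hQ : IsPeriodic H Q) : IsPeriodic H (P ∪ Q) := by
  rintro x (hx | hx) h hh
  · exact Or.inl (hP x hx h hh)
  · exact Or.inr (hQ x hx h hh)

lemma inter (hP : IsPeriodic H P) (hQ : IsPeriodic H Q) : IsPeriodic H (P ∩ Q) :=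
  fun x hx h hh => ⟨hP x hx.1 h hh, hQ x hx.2 h hh⟩

lemma add_subgroup (S : Set G) (H : AddSubgroup G) : IsPeriodic H (S + (H : Set G)) := by
  rintro _ ⟨s, hs, k, hk, rfl⟩ h hh
  exact ⟨s, hs, k + h, H.add_mem hk hh, (add_assoc _ _ _).symm⟩

lemma preimage_image (hP : IsPeriodic H P) :
    (fun x : G => (x : G ⧸ H)) ⁻¹' ((fun x : G => (x : G ⧸ H)) '' P) = P := by
  refine Set.Subset.antisymm ?_ (Set.subset_preimage_image _ _)
  rintro x ⟨y, hy, hyx⟩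
  have := hP y hy _ (QuotientAddGroup.eq.1 hyx)
  simpa using this

lemma image_map (hP : IsPeriodic H P) (K : AddSubgroup G) :
    IsPeriodic (H.map (QuotientAddGroup.mk' K)) ((fun x : G => (x : G ⧸ K)) '' P) := by
  rintro _ ⟨x, hx, rfl⟩ _ ⟨h, hh, rfl⟩
  exact ⟨x + h, hP x hx h hh, rfl⟩

end IsPeriodic

lemma ncard_mul_le [Finite G] {H₁ H₂ : AddSubgroup G} (h : H₁ ⊓ H₂ = ⊥) {S T D : Set G}
    (hS : S ⊆ H₁) (hT : T ⊆ H₂) (x : G) (hD : ∀ a ∈ S, ∀ b ∈ T, x + a + b ∈ D) :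
    S.ncard * T.ncard ≤ D.ncard := by
  rw [← Set.ncard_prod]
  refine Set.ncard_le_ncard_of_injOn (fun p => x + p.1 + p.2) (fun p hp => hD _ hp.1 _ hp.2) ?_
  rintro ⟨a, b⟩ ⟨ha, hb⟩ ⟨c, d⟩ ⟨hc, hd⟩ heq
  simp only at ha hb hc hd heq
  rw [add_assoc, add_assoc, add_right_inj] at heq
  have h1 : a - c = d - b := by rw [sub_eq_sub_iff_add_eq_add, heq, add_comm]
  have h2 : a - c ∈ H₁ ⊓ H₂ :=
    ⟨H₁.sub_mem (hS ha) (hS hc), h1 ▸ H₂.sub_mem (hT hd) (hT hb)⟩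
  rw [h, AddSubgroup.mem_bot] at h2
  rw [h2] at h1
  rw [sub_eq_zero.1 h2, sub_eq_zero.1 h1.symm]

lemma exists_counts [Finite G] {H₁ H₂ : AddSubgroup G} (h : H₁ ⊓ H₂ = ⊥) {P₁ P₂ : Set G}
    (h₁ : IsPeriodic H₁ P₁) (h₂ : IsPeriodic H₂ P₂) {x : G} (hx₂ : x ∈ P₂) (hx₁ : x ∉ P₁) :
    ∃ p q s t : ℕ, 1 ≤ p ∧ 1 ≤ q ∧ p + s = (H₁ : Set G).ncard ∧ q + t = (H₂ : Set G).ncard ∧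
      p * q ≤ (P₂ \ P₁).ncard ∧ s * t ≤ (P₁ \ P₂).ncard := by
  have hpos : ∀ S : Set G, (0 : G) ∈ S → 1 ≤ S.ncard := fun S hS =>
    (Set.ncard_pos (Set.toFinite S)).2 ⟨0, hS⟩
  refine ⟨({a ∈ (H₁ : Set G) | x + a ∈ P₂}).ncard, ({b ∈ (H₂ : Set G) | x + b ∉ P₁}).ncard,
    ((H₁ : Set G) \ {a ∈ (H₁ : Set G) | x + a ∈ P₂}).ncard,
    ((H₂ : Set G) \ {b ∈ (H₂ : Set G) | x + b ∉ P₁}).ncard,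
    hpos _ ⟨H₁.zero_mem, by simpa⟩, hpos _ ⟨H₂.zero_mem, by simpa⟩,
    (add_comm _ _).trans (Set.ncard_sdiff_add_ncard_of_subset (Set.sep_subset _ _)),
    (add_comm _ _).trans (Set.ncard_sdiff_add_ncard_of_subset (Set.sep_subset _ _)), ?_, ?_⟩
  · refine ncard_mul_le h (Set.sep_subset _ _) (Set.sep_subset _ _) x ?_
    rintro a ⟨ha, ha'⟩ b ⟨hb, hb'⟩
    refine ⟨(h₂.add_mem_iff hb).2 ha', ?_⟩
    rwa [add_right_comm, h₁.add_mem_iff ha]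
  · refine ncard_mul_le h Set.sdiff_subset Set.sdiff_subset x ?_
    rintro a ⟨ha, ha'⟩ b ⟨hb, hb'⟩
    have ha'' : x + a ∉ P₂ := fun h' => ha' ⟨ha, h'⟩
    have hb'' : x + b ∈ P₁ := by by_contra h'; exact hb' ⟨hb, h'⟩
    refine ⟨?_, by rwa [h₂.add_mem_iff hb]⟩
    rwa [add_right_comm, h₁.add_mem_iff ha]

lemma counts_aux {p q s t a b : ℕ} (hp : 1 ≤ p) (hq : 1 ≤ q) (ha : a + 2 ≤ p + s)
    (hb : b + 2 ≤ q + t) (h1 : p * q ≤ a) (h2 : s * t ≤ b) : t = 0 := by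
  rcases Nat.eq_zero_or_pos s with rfl | hs
  · nlinarith
  by_contra ht
  have ht : 1 ≤ t := Nat.one_le_iff_ne_zero.2 ht
  obtain ⟨p, rfl⟩ := Nat.exists_eq_add_of_le hp
  obtain ⟨q, rfl⟩ := Nat.exists_eq_add_of_le hq
  obtain ⟨s, rfl⟩ := Nat.exists_eq_add_of_le hs
  obtain ⟨t, rfl⟩ := Nat.exists_eq_add_of_le ht
  nlinarith [Nat.zero_le (p * q), Nat.zero_le (s * t)]

lemma ncard_le_or_ncard_le [Finite G] {H₁ H₂ : AddSubgroup G} (h : H₁ ⊓ H₂ = ⊥) {P₁ P₂ : Set G}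
    (h₁ : IsPeriodic H₁ P₁) (h₂ : IsPeriodic H₂ P₂) (h21 : ¬ P₂ ⊆ P₁) (h12 : ¬ P₁ ⊆ P₂) :
    (H₁ : Set G).ncard ≤ (P₂ \ P₁).ncard + 1 ∨ (H₂ : Set G).ncard ≤ (P₁ \ P₂).ncard + 1 := by
  obtain ⟨x, hx2, hx1⟩ := Set.not_subset.1 h21
  obtain ⟨y, hy1, hy2⟩ := Set.not_subset.1 h12
  obtain ⟨p, q, s, t, hp, hq, hps, hqt, hpq, hst⟩ := exists_counts h h₁ h₂ hx2 hx1
  obtain ⟨p', q', s', t', hp', hq', hps', hqt', hpq', hst'⟩ :=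
    exists_counts (inf_comm H₁ H₂ ▸ h) h₂ h₁ hy1 hy2
  by_contra! hc
  have e1 := counts_aux hp hq (by omega) (by omega) hpq hst
  have e2 := counts_aux hp' hq' (by omega) (by omega) hpq' hst'
  subst e1 e2
  nlinarith

namespace IsMean

variable {φ : (G → ℝ) → ℝ} (hφ : IsMean φ)
include hφ

lemma mass_of_isPeriodic {H : AddSubgroup G} [H.FiniteIndex] {P : Set G} (hP : IsPeriodic H P) :
    φ (ind P) = ((fun x : G => (x : G ⧸ H)) '' P).ncard / H.index := by
  rw [← hφ.preimage_mass, hP.preimage_image]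

lemma mass_subgroup (H : AddSubgroup G) [H.FiniteIndex] :
    φ (ind (H : Set G)) = 1 / H.index := by
  rw [← hφ.coset_mass H 0]
  congr 2
  ext x
  exact (QuotientAddGroup.eq_zero_iff x).symm

lemma eq_empty_of_null {H : AddSubgroup G} [H.FiniteIndex] {P : Set G} (hP : IsPeriodic H P)
    (h0 : φ (ind P) = 0) : P = ∅ := by
  rw [hφ.mass_of_isPeriodic hP, div_eq_zero_iff] at h0
  have hi : (H.index : ℝ) ≠ 0 := Nat.cast_ne_zero.2 AddSubgroup.FiniteIndex.index_ne_zero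
  have : Finite (G ⧸ H) := inferInstance
  simpa [hi, Set.ncard_eq_zero (Set.toFinite _)] using h0

/-- The union lemma: periodic sets with large mean are stable under unions. -/
lemma union_mass {H₁ H₂ : AddSubgroup G} [H₁.FiniteIndex] [H₂.FiniteIndex] {P₁ P₂ : Set G}
    (h₁ : IsPeriodic H₁ P₁) (h₂ : IsPeriodic H₂ P₂) (h21 : ¬ P₂ ⊆ P₁) (h12 : ¬ P₁ ⊆ P₂) {M : ℝ}
    (hM₁ : M ≤ φ (ind P₁) + 1 / H₁.index) (hM₂ : M ≤ φ (ind P₂) + 1 / H₂.index) :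
    M ≤ φ (ind (P₁ ∪ P₂)) + 1 / (H₁ ⊓ H₂ : AddSubgroup G).index := by
  set L := H₁ ⊓ H₂ with hL
  let π : G → G ⧸ L := fun x => (x : G ⧸ L)
  have : Finite (G ⧸ L) := inferInstance
  have hi : (0 : ℝ) < L.index := by
    exact_mod_cast Nat.pos_of_ne_zero AddSubgroup.FiniteIndex.index_ne_zero
  have hL1 : L ≤ H₁ := inf_le_left
  have hL2 : L ≤ H₂ := inf_le_right
  have hdiff : ∀ {P Q : Set G}, IsPeriodic L P → IsPeriodic L Q →
      φ (ind (P \ Q)) = (π '' P \ π '' Q).ncard / L.index := by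
    intro P Q hP hQ
    rw [← hφ.preimage_mass, Set.preimage_sdiff]
    simp only [π, hP.preimage_image, hQ.preimage_image]
  have hsub : ∀ {P Q : Set G}, IsPeriodic L Q → π '' P ⊆ π '' Q → P ⊆ Q := by
    intro P Q hQ h
    rw [← hQ.preimage_image]
    exact Set.image_subset_iff.1 h
  have hH : ∀ {H : AddSubgroup G} [H.FiniteIndex], L ≤ H →
      1 / (H.index : ℝ) = ((H.map (QuotientAddGroup.mk' L) : Set (G ⧸ L)).ncard : ℝ) / L.index := by
    intro H _ hLH
    rw [← hφ.mass_subgroup H, hφ.mass_of_isPeriodic (H := L)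
      (P := (H : Set G)) fun x hx h hh => H.add_mem hx (hLH hh)]
    rfl
  have hinf : H₁.map (QuotientAddGroup.mk' L) ⊓ H₂.map (QuotientAddGroup.mk' L) = ⊥ := by
    rw [eq_bot_iff]
    rintro _ ⟨⟨a, ha, rfl⟩, ⟨b, hb, hab⟩⟩
    have h1 : -b + a ∈ L := QuotientAddGroup.eq.1 hab
    have h2 : a ∈ H₂ := by simpa using H₂.add_mem hb (hL2 h1)
    exact (QuotientAddGroup.eq_zero_iff a).2 ⟨ha, h2⟩
  have e1 : φ (ind (P₁ ∪ P₂)) = φ (ind P₁) + φ (ind (P₂ \ P₁)) := by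
    have := hφ.ind_diff_of_subset (Set.subset_union_left : P₁ ⊆ P₁ ∪ P₂)
    rw [Set.union_sdiff_left] at this
    linarith
  have e2 : φ (ind (P₁ ∪ P₂)) = φ (ind P₂) + φ (ind (P₁ \ P₂)) := by
    have := hφ.ind_diff_of_subset (Set.subset_union_right : P₂ ⊆ P₁ ∪ P₂)
    rw [Set.union_sdiff_right] at this
    linarith
  rw [hdiff (h₂.mono hL2) (h₁.mono hL1)] at e1
  rw [hdiff (h₁.mono hL1) (h₂.mono hL2)] at e2
  rw [hH hL1] at hM₁
  rw [hH hL2] at hM₂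
  rcases ncard_le_or_ncard_le hinf (h₁.image_map L) (h₂.image_map L)
    (fun h => h21 (hsub (h₁.mono hL1) h)) (fun h => h12 (hsub (h₂.mono hL2) h)) with h | h
  · rw [e1, add_assoc, ← add_div]
    refine hM₁.trans ?_
    gcongr
    exact_mod_cast h
  · rw [e2, add_assoc, ← add_div]
    refine hM₂.trans ?_
    gcongr
    exact_mod_cast h

end IsMean

end Periodic

section Kneser

variable {G : Type*} [AddCommGroup G]

/-- The subgroup of periods of a set. -/
def stab (P : Set G) : AddSubgroup G where
  carrier := {k | ∀ x, x + k ∈ P ↔ x ∈ P}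
  zero_mem' := by simp
  add_mem' {a b} ha hb x := by rw [← add_assoc, hb, ha]
  neg_mem' {a} ha x := by rw [← ha, neg_add_cancel_right]

lemma IsPeriodic.le_stab {H : AddSubgroup G} {P : Set G} (hP : IsPeriodic H P) : H ≤ stab P :=
  fun _ hh _ => hP.add_mem_iff hh

lemma isPeriodic_stab (P : Set G) : IsPeriodic (stab P) P := fun x hx _ hh => (hh x).2 hx

lemma subset_add_subgroup (S : Set G) (H : AddSubgroup G) : S ⊆ S + (H : Set G) :=
  fun x hx => ⟨x, hx, 0, H.zero_mem, add_zero x⟩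

lemma IsPeriodic.add_subset {H : AddSubgroup G} {S P : Set G} (hP : IsPeriodic H P) (h : S ⊆ P) :
    S + (H : Set G) ⊆ P := by
  rintro _ ⟨x, hx, k, hk, rfl⟩
  exact hP x (h hx) k hk

lemma add_subgroup_add_add_subgroup (A B : Set G) (K : AddSubgroup G) :
    A + (K : Set G) + (B + (K : Set G)) = A + B + (K : Set G) := by
  rw [add_add_add_comm]
  congr 1
  refine Set.Subset.antisymm ?_ (subset_add_subgroup _ K)
  rintro _ ⟨x, hx, y, hy, rfl⟩
  exact K.add_mem hx hy

namespace IsErgodic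

variable {φ : (G → ℝ) → ℝ} (hE : IsErgodic φ)
include hE

lemma exists_periodic_hull {A B : Set G} (hA : A.Nonempty) (hB : B.Nonempty) {s : ℝ} (hs : 0 < s)
    (hAB : φ (ind (A + B)) < φ (ind A) + φ (ind B) - s) :
    ∃ H : AddSubgroup G, H.FiniteIndex ∧
      φ (ind ((A + B + (H : Set G)) \ (A + B))) = 0 ∧
      φ (ind A) + φ (ind B) - s ≤ φ (ind (A + B + (H : Set G))) + 1 / H.index := by
  have hφ := hE.isMean
  set M := φ (ind A) + φ (ind B) - s with hM
  let F : AddSubgroup G → Set G → Prop := fun H P => H.FiniteIndex ∧ IsPeriodic H P ∧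
    φ (ind (P \ (A + B))) = 0 ∧ M ≤ φ (ind P) + 1 / H.index
  have hper : ∀ c ∈ A + B, ∃ H P, F H P ∧ c ∈ P := fun c hc => by
    obtain ⟨H, hH, P, h1, h2, h3, h4⟩ := hE.exists_periodic (by linarith) hs hc
    exact ⟨H, P, ⟨hH, h1, h3, h4⟩, h2⟩
  obtain ⟨N, hN⟩ := exists_nat_gt (1 / (M - φ (ind (A + B))))
  have hidx : ∀ H P, F H P → H.index ≤ N := by
    rintro H P ⟨hH, -, h2, h3⟩
    have h4 : φ (ind P) ≤ φ (ind (A + B)) := by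
      have h5 := hφ.ind_diff_add_inter P (A + B)
      have h6 := hφ.ind_mono (Set.inter_subset_right : P ∩ (A + B) ⊆ A + B)
      linarith
    have hi : (0 : ℝ) < H.index := by
      exact_mod_cast Nat.pos_of_ne_zero AddSubgroup.FiniteIndex.index_ne_zero
    have h7 : M - φ (ind (A + B)) ≤ 1 / H.index := by linarith
    have h8 : (H.index : ℝ) ≤ 1 / (M - φ (ind (A + B))) := by
      rw [le_div_iff₀ (by linarith)]
      rwa [le_div_iff₀ hi, mul_comm] at h7
    exact_mod_cast (h8.trans hN.le)
  have hint : ∀ H P, F H P → ∃ k : ℕ, φ (ind P) * (N.factorial : ℝ) = k := by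
    intro H P hF
    have := hF.1
    have hi : H.index ≠ 0 := AddSubgroup.FiniteIndex.index_ne_zero
    obtain ⟨d, hd⟩ := Nat.dvd_factorial (Nat.pos_of_ne_zero hi) (hidx H P hF)
    refine ⟨((fun x : G => (x : G ⧸ H)) '' P).ncard * d, ?_⟩
    rw [hφ.mass_of_isPeriodic hF.2.1, hd]
    push_cast
    field_simp
  have hNf : (0 : ℝ) < N.factorial := by exact_mod_cast N.factorial_pos
  obtain ⟨H, P, hF, hmax⟩ : ∃ H P, F H P ∧ ∀ H' P', F H' P' → φ (ind P') ≤ φ (ind P) := by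
    set V : Set ℕ := {k | ∃ H P, F H P ∧ φ (ind P) * (N.factorial : ℝ) = k} with hV
    have hbdd : BddAbove V := by
      refine ⟨N.factorial, ?_⟩
      rintro k ⟨H, P, -, hk⟩
      have h1 := hφ.ind_le_one P
      have : (k : ℝ) ≤ N.factorial := by rw [← hk]; nlinarith
      exact_mod_cast this
    have hne : V.Nonempty := by
      obtain ⟨c, hc⟩ := hA.add hB
      obtain ⟨H, P, hF, -⟩ := hper c hc
      obtain ⟨k, hk⟩ := hint H P hF
      exact ⟨k, H, P, hF, hk⟩
    obtain ⟨H, P, hF, hk⟩ := Nat.sSup_mem hne hbdd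
    refine ⟨H, P, hF, fun H' P' hF' => ?_⟩
    obtain ⟨k', hk'⟩ := hint H' P' hF'
    have hle : k' ≤ sSup V := le_csSup hbdd ⟨H', P', hF', hk'⟩
    have : (k' : ℝ) ≤ (sSup V : ℕ) := by exact_mod_cast hle
    rw [← hk, ← hk'] at this
    exact le_of_mul_le_mul_right this hNf
  obtain ⟨hH, hP1, hP2, hP3⟩ := hF
  have hsub : A + B ⊆ P := by
    intro c hc
    obtain ⟨H', P', hF', hcP⟩ := hper c hc
    have hF'' := hF'
    obtain ⟨hH', hP1', hP2', hP3'⟩ := hF'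
    suffices h : P' ⊆ P from h hcP
    by_contra hn
    have hle : φ (ind (P ∪ P')) ≤ φ (ind P) := by
      by_cases h : P ⊆ P'
      · rw [Set.union_eq_right.2 h]
        exact hmax _ _ hF''
      · refine hmax (H ⊓ H') _ ⟨inferInstance,
          (hP1.mono inf_le_left).union (hP1'.mono inf_le_right), ?_,
          hφ.union_mass hP1 hP1' hn h hP3 hP3'⟩
        rw [Set.union_sdiff_distrib]
        exact hφ.ind_union_null hP2 hP2'
    have h0 : φ (ind (P' \ P)) = 0 := by
      have h1 := hφ.ind_diff_of_subset (Set.subset_union_left : P ⊆ P ∪ P')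
      rw [Set.union_sdiff_left] at h1
      exact le_antisymm (by linarith) (hφ.ind_nonneg _)
    have h2 := hφ.eq_empty_of_null (H := H ⊓ H')
      ((hP1'.mono inf_le_right).diff (hP1.mono inf_le_left)) h0
    exact hn (Set.sdiff_eq_empty.1 h2)
  have hPe : P = A + B + (H : Set G) := by
    refine Set.Subset.antisymm (Set.sdiff_eq_empty.1 ?_) (hP1.add_subset hsub)
    refine hφ.eq_empty_of_null (hP1.diff (IsPeriodic.add_subgroup _ H)) (hφ.ind_null_mono ?_ hP2)
    exact Set.sdiff_subset_sdiff_right (subset_add_subgroup _ H)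
  subst hPe
  exact ⟨H, hH, hP2, hP3⟩

lemma exists_stab {A B : Set G} (hA : A.Nonempty) (hB : B.Nonempty) {s : ℝ} (hs : 0 < s)
    (hAB : φ (ind (A + B)) < φ (ind A) + φ (ind B) - s) :
    ∃ K : AddSubgroup G, K.FiniteIndex ∧ stab (A + B + (K : Set G)) = K ∧
      φ (ind ((A + B + (K : Set G)) \ (A + B))) = 0 ∧
      φ (ind A) + φ (ind B) - s ≤ φ (ind (A + B + (K : Set G))) + 1 / K.index := by
  obtain ⟨H, hH, h1, h2⟩ := hE.exists_periodic_hull hA hB hs hAB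
  set P := A + B + (H : Set G) with hP
  have hle : H ≤ stab P := (IsPeriodic.add_subgroup _ H).le_stab
  have hfin : (stab P).FiniteIndex := AddSubgroup.finiteIndex_of_le hle
  have hPe : A + B + (stab P : Set G) = P :=
    Set.Subset.antisymm ((isPeriodic_stab P).add_subset (subset_add_subgroup _ H))
      (Set.add_subset_add_left hle)
  refine ⟨stab P, hfin, by rw [hPe], by rwa [hPe], ?_⟩
  rw [hPe]
  refine h2.trans ?_
  have hi : (0 : ℝ) < (stab P).index := by
    exact_mod_cast Nat.pos_of_ne_zero AddSubgroup.FiniteIndex.index_ne_zero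
  have : (stab P).index ≤ H.index :=
    Nat.le_of_dvd (Nat.pos_of_ne_zero AddSubgroup.FiniteIndex.index_ne_zero)
      (AddSubgroup.index_dvd_of_le hle)
  gcongr

/-- Kneser's inequality for periodic sets. -/
lemma kneser {A B : Set G} (hA : A.Nonempty) (hB : B.Nonempty) {K : AddSubgroup G}
    [K.FiniteIndex] (hK : stab (A + B + (K : Set G)) = K) :
    φ (ind (A + (K : Set G))) + φ (ind (B + (K : Set G))) ≤
      φ (ind (A + B + (K : Set G))) + 1 / K.index := by
  have hφ := hE.isMean
  by_contra! hc
  have hKn : (K : Set G).Nonempty := ⟨0, K.zero_mem⟩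
  have hi : (0 : ℝ) ≤ 1 / K.index := by positivity
  set s := (φ (ind (A + (K : Set G))) + φ (ind (B + (K : Set G))) -
      (φ (ind (A + B + (K : Set G))) + 1 / K.index)) / 2 with hs
  obtain ⟨H, hH, h1, h2, h3⟩ := hE.exists_stab (s := s) (hA.add hKn) (hB.add hKn)
    (by linarith) (by rw [add_subgroup_add_add_subgroup]; linarith)
  rw [add_subgroup_add_add_subgroup] at h1 h2 h3
  have he : A + B + (K : Set G) + (H : Set G) = A + B + (K : Set G) := by
    refine Set.Subset.antisymm (Set.sdiff_eq_empty.1 ?_) (subset_add_subgroup _ H)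
    exact hφ.eq_empty_of_null (H := H ⊓ K) (((IsPeriodic.add_subgroup _ H).mono inf_le_left).diff
      ((IsPeriodic.add_subgroup _ K).mono inf_le_right)) h2
  rw [he] at h1 h3
  rw [hK] at h1
  subst h1
  linarith

lemma add_subgroup_eq {A B : Set G} (hA : A.Nonempty) (hB : B.Nonempty) {K L : AddSubgroup G}
    [K.FiniteIndex] [L.FiniteIndex] (hL : L ≤ K) (hK : stab (A + B + (K : Set G)) = K)
    (h0 : φ (ind ((A + B + (K : Set G)) \ (A + B))) = 0)
    (hAB : φ (ind (A + B)) < φ (ind A) + φ (ind B)) :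
    A + B + (L : Set G) = A + B + (K : Set G) := by
  have hφ := hE.isMean
  refine Set.Subset.antisymm (Set.add_subset_add_left hL) ?_
  rintro _ ⟨_, ⟨a, ha, b, hb, rfl⟩, k, hk, rfl⟩
  by_contra hx
  set x := a + b + k with hx'
  have hbound : ∀ {S : Set G} {u : G}, u ∈ S →
      φ (ind S) + 1 / K.index ≤
        φ (ind (S + (K : Set G))) + φ (ind ((S + (L : Set G)) ∩ coset K (u : G ⧸ K))) := by
    intro S u hu
    have h1 := hφ.ind_union_add_inter (S + (L : Set G)) (coset K (u : G ⧸ K))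
    have h2 : (S + (L : Set G)) ∪ coset K (u : G ⧸ K) ⊆ S + (K : Set G) := by
      refine Set.union_subset (Set.add_subset_add_left hL) fun y hy => ?_
      refine ⟨u, hu, -u + y, QuotientAddGroup.eq.1 hy.symm, by simp⟩
    have h3 := hφ.ind_mono h2
    have h4 := hφ.ind_mono (subset_add_subgroup S L)
    rw [hφ.coset_mass] at h1
    linarith
  have hcos : ∀ q : G ⧸ K, IsPeriodic L (coset K q) := by
    intro q y hy h hh
    rw [mem_coset] at hy ⊢
    rw [QuotientAddGroup.mk_add, (QuotientAddGroup.eq_zero_iff h).2 (hL hh), add_zero, hy]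
  have hA2 := (IsPeriodic.add_subgroup A L).inter (hcos a)
  have hB2 := (IsPeriodic.add_subgroup B L).inter (hcos b)
  set A2 := (A + (L : Set G)) ∩ coset K (a : G ⧸ K) with hA2e
  set B2 := (B + (L : Set G)) ∩ coset K (b : G ⧸ K) with hB2e
  have hR : φ (ind {y | x - y ∈ B2}) = φ (ind B2) := by
    have hR' : IsPeriodic L {y | x - y ∈ B2} := by
      intro y hy h hh
      have := hB2 _ hy _ (L.neg_mem hh)
      rwa [Set.mem_ofPred_eq, ← sub_sub, sub_eq_add_neg (x - y)]
    rw [hφ.mass_of_isPeriodic hR', hφ.mass_of_isPeriodic hB2,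
      ← Set.ncard_image_of_injective _ (sub_right_injective (b := (x : G ⧸ L)))]
    congr 3
    ext q
    constructor
    · rintro ⟨_, ⟨y, hy, rfl⟩, rfl⟩
      exact ⟨x - y, hy, rfl⟩
    · rintro ⟨y, hy, rfl⟩
      refine ⟨_, ⟨x - y, by simpa using hy, rfl⟩, ?_⟩
      exact congrArg (fun z : G => (z : G ⧸ L)) (sub_sub_cancel x y)
  have hdisj : A2 ∩ {y | x - y ∈ B2} = ∅ := by
    refine Set.eq_empty_of_forall_notMem ?_
    rintro y ⟨⟨⟨a', ha', l, hl, rfl⟩, -⟩, ⟨b', hb', l', hl', hbl⟩, -⟩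
    refine hx ⟨a' + b', Set.add_mem_add ha' hb', l + l', L.add_mem hl hl', ?_⟩
    have hbl' : b' + l' = x - (a' + l) := hbl
    change a' + b' + (l + l') = x
    rw [add_add_add_comm, hbl']
    abel
  have hsub : A2 ∪ {y | x - y ∈ B2} ⊆ coset K (a : G ⧸ K) := by
    refine Set.union_subset Set.inter_subset_right ?_
    rintro y ⟨-, hy⟩
    rw [mem_coset, QuotientAddGroup.mk_sub, hx', QuotientAddGroup.mk_add, QuotientAddGroup.mk_add,
      (QuotientAddGroup.eq_zero_iff k).2 hk, add_zero, sub_eq_iff_eq_add, add_comm,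
      add_right_inj] at hy
    exact hy.symm
  have h1 := hφ.ind_union_add_inter A2 {y | x - y ∈ B2}
  have h2 := (hφ.ind_mono hsub).trans_eq (hφ.coset_mass K _)
  have h3 : φ (ind (A2 ∩ {y | x - y ∈ B2})) = 0 := by
    have : ind (∅ : Set G) = fun _ => 0 := by funext x; simp [ind]
    rw [hdisj, this, hφ.const]
  have h4 := hE.kneser hA hB hK
  have h5 := hbound ha
  have h6 := hbound hb
  have h7 := hφ.ind_diff_of_subset (subset_add_subgroup (A + B) K)
  linarith

end IsErgodic

/-- A finite index subgroup controlling all ergodic means for which `A + B` is small. -/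
lemma exists_uniform_subgroup {A B : Set G} (hA : A.Nonempty) (hB : B.Nonempty) :
    ∃ K : AddSubgroup G, K.FiniteIndex ∧ ∀ ψ : (G → ℝ) → ℝ, IsErgodic ψ →
      ψ (ind A) + ψ (ind B) - ψ (ind (A + B)) ≤ 1 / K.index ∧
      (0 < ψ (ind A) + ψ (ind B) - ψ (ind (A + B)) →
        ψ (ind ((A + B + (K : Set G)) \ (A + B))) = 0) := by
  have key : ∀ ψ : (G → ℝ) → ℝ, IsErgodic ψ → 0 < ψ (ind A) + ψ (ind B) - ψ (ind (A + B)) →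
      ∃ K : AddSubgroup G, K.FiniteIndex ∧ stab (A + B + (K : Set G)) = K ∧
        ψ (ind ((A + B + (K : Set G)) \ (A + B))) = 0 := by
    intro ψ hψ hg
    obtain ⟨K, h1, h2, h3, -⟩ := hψ.exists_stab hA hB (half_pos hg) (by linarith)
    exact ⟨K, h1, h2, h3⟩
  by_cases hex : ∃ ψ : (G → ℝ) → ℝ, IsErgodic ψ ∧ 0 < ψ (ind A) + ψ (ind B) - ψ (ind (A + B))
  · obtain ⟨φ, hφ, hg⟩ := hex
    obtain ⟨K, hK, hst, h0⟩ := key φ hφ hg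
    have hnull : ∀ ψ : (G → ℝ) → ℝ, IsErgodic ψ → 0 < ψ (ind A) + ψ (ind B) - ψ (ind (A + B)) →
        ψ (ind ((A + B + (K : Set G)) \ (A + B))) = 0 := by
      intro ψ hψ hgψ
      obtain ⟨K', hK', hst', h0'⟩ := key ψ hψ hgψ
      have e1 := hφ.add_subgroup_eq hA hB (inf_le_left : K ⊓ K' ≤ K) hst h0 (by linarith)
      have e2 := hψ.add_subgroup_eq hA hB (inf_le_right : K ⊓ K' ≤ K') hst' h0' (by linarith)
      rwa [← e1, e2]
    refine ⟨K, hK, fun ψ hψ => ⟨?_, hnull ψ hψ⟩⟩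
    rcases le_or_gt (ψ (ind A) + ψ (ind B) - ψ (ind (A + B))) 0 with h | h
    · exact h.trans (by positivity)
    · have h1 := hψ.kneser hA hB hst
      have h2 := hψ.isMean.ind_diff_of_subset (subset_add_subgroup (A + B) K)
      have h3 := hψ.isMean.ind_mono (subset_add_subgroup A K)
      have h4 := hψ.isMean.ind_mono (subset_add_subgroup B K)
      have h5 := hnull ψ hψ h
      linarith
  · push Not at hex
    exact ⟨⊤, inferInstance, fun ψ hψ => ⟨(hex ψ hψ).trans (by positivity),
      fun h => absurd h (not_lt.2 (hex ψ hψ))⟩⟩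

end Kneser

section Limits

variable {G : Type*} [AddCommGroup G]

/-- Limits along an ultrafilter of asymptotically invariant positive functionals are, up to
normalisation, invariant means. -/
lemma exists_mean_of_ultrafilter (U : Ultrafilter ℕ) (Λ : ℕ → (G → ℝ) → ℝ)
    (hadd : ∀ j {f g : G → ℝ}, Bdd f → Bdd g → Λ j (fun x => f x + g x) = Λ j f + Λ j g)
    (hsmul : ∀ j (c : ℝ) {f : G → ℝ}, Bdd f → Λ j (fun x => c * f x) = c * Λ j f)
    (hnonneg : ∀ j {f : G → ℝ}, Bdd f → (∀ x, 0 ≤ f x) → 0 ≤ Λ j f)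
    (hle : ∀ j, Λ j (fun _ => 1) ≤ 1) {m : ℝ} (hm : 0 < m)
    (hone : Tendsto (fun j => Λ j (fun _ => 1)) U (nhds m))
    (hshift : ∀ (t : G) {f : G → ℝ}, Bdd f →
      Tendsto (fun j => Λ j (fun x => f (x + t)) - Λ j f) U (nhds 0)) :
    ∃ ψ : (G → ℝ) → ℝ, IsMean ψ ∧ ∀ {f : G → ℝ}, Bdd f →
      Tendsto (fun j => Λ j f) U (nhds (m * ψ f)) := by
  classical
  have hlim : ∀ f : G → ℝ, Bdd f → ∃ l, Tendsto (fun j => Λ j f) U (nhds l) := by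
    rintro f ⟨C, hC⟩
    have hf : Bdd f := ⟨C, hC⟩
    have hC0 : 0 ≤ C := (abs_nonneg _).trans (hC 0)
    have hb : ∀ j, Λ j f ∈ Set.Icc (-C) C := by
      intro j
      have h1 := hnonneg j (hf.neg.add (Bdd.const C)) fun x => by
        have := (abs_le.1 (hC x)).2; linarith
      have h2 := hnonneg j (hf.add (Bdd.const C)) fun x => by
        have := (abs_le.1 (hC x)).1; linarith
      have h3 : Λ j (fun _ => C) = C * Λ j (fun _ => 1) := by
        simpa using hsmul j C (Bdd.const (G := G) 1)
      have h4 : Λ j (fun x => -f x) = -Λ j f := by simpa using hsmul j (-1) hf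
      rw [hadd j hf.neg (Bdd.const C), h3, h4] at h1
      rw [hadd j hf (Bdd.const C), h3] at h2
      have := hle j
      constructor <;> nlinarith
    obtain ⟨l, -, hl⟩ := (isCompact_Icc (a := -C) (b := C)).ultrafilter_le_nhds
      (U.map fun j => Λ j f) (by
        rw [le_principal_iff]
        exact (Filter.Eventually.of_forall hb : ∀ᶠ j in (U : Filter ℕ), Λ j f ∈ Set.Icc (-C) C))
    exact ⟨l, hl⟩
  choose! L hL using hlim
  have huniq : ∀ {f : G → ℝ} (_ : Bdd f) {l : ℝ}, Tendsto (fun j => Λ j f) U (nhds l) →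
      L f = l := fun hf _ hl => tendsto_nhds_unique (hL _ hf) hl
  refine ⟨fun f => if Bdd f then m⁻¹ * L f else 0, ⟨?_, ?_, ?_, ?_, ?_, ?_⟩, ?_⟩
  · intro f g hf hg
    simp only [hf, hg, hf.add hg, if_true]
    rw [huniq (hf.add hg) (((hL _ hf).add (hL _ hg)).congr fun j => (hadd j hf hg).symm), mul_add]
  · intro c f hf
    have hcf : Bdd fun x => c * f x := (Bdd.const c).mul hf
    simp only [hf, hcf, if_true]
    rw [huniq hcf (((hL _ hf).const_mul c).congr fun j => (hsmul j c hf).symm)]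
    ring
  · intro f hf h0
    simp only [hf, if_true]
    exact mul_nonneg (inv_nonneg.2 hm.le)
      (ge_of_tendsto (hL _ hf) (Filter.Eventually.of_forall fun j => hnonneg j hf h0))
  · simp only [Bdd.const, if_true]
    rw [huniq (Bdd.const 1) hone, inv_mul_cancel₀ hm.ne']
  · intro t f hf
    have hft : Bdd fun x => f (x + t) := hf.comp _
    simp only [hf, hft, if_true]
    rw [huniq hft (l := L f)]
    simpa using (hshift t hf).add (hL _ hf)
  · intro f hf
    simp [hf]
  · intro f hf
    simp only [hf, if_true]
    rw [mul_inv_cancel_left₀ hm.ne']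
    exact hL _ hf

namespace IsMean

variable {φ : (G → ℝ) → ℝ} (hφ : IsMean φ)
include hφ

lemma exists_restrict (U : Ultrafilter ℕ) (E : ℕ → Set G) {m : ℝ} (hm : 0 < m)
    (hE : Tendsto (fun j => φ (ind (E j))) U (nhds m))
    (hinv : ∀ t, Tendsto (fun j => φ (ind (symmDiff (E j) ((fun x => x + t) ⁻¹' E j)))) U
      (nhds 0)) :
    ∃ ψ : (G → ℝ) → ℝ, IsMean ψ ∧ ∀ X : Set G,
      Tendsto (fun j => φ (ind (X ∩ E j))) U (nhds (m * ψ (ind X))) := by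
  have hb : ∀ {f : G → ℝ} j, Bdd f → Bdd fun x => f x * ind (E j) x := fun j hf =>
    hf.mul (Bdd.ind _)
  have hshift : ∀ (t : G) {f : G → ℝ}, Bdd f → Tendsto (fun j =>
      φ (fun x => f (x + t) * ind (E j) x) - φ fun x => f x * ind (E j) x) U (nhds 0) := by
    intro t f hf
    obtain ⟨C, hC⟩ := hf
    have hf : Bdd f := ⟨C, hC⟩
    have hft : Bdd fun x => f (x + t) := hf.comp _
    refine squeeze_zero_norm (fun j => ?_) (by simpa using (hinv t).const_mul C)
    have hs : Bdd fun x => f (x + t) * ind (E j) (x + t) := (hb j hf).comp _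
    rw [Real.norm_eq_abs, ← hφ.shift t (hb j hf), ← hφ.sub (hb j hft) hs,
      ← hφ.smul C (Bdd.ind _)]
    have hbd : Bdd fun x => C * ind (symmDiff (E j) ((fun x => x + t) ⁻¹' E j)) x :=
      (Bdd.const C).mul (Bdd.ind _)
    have hpt : ∀ x, |f (x + t) * ind (E j) x - f (x + t) * ind (E j) (x + t)| ≤
        C * ind (symmDiff (E j) ((fun x => x + t) ⁻¹' E j)) x := by
      intro x
      have := hC (x + t)
      have hC0 : 0 ≤ C := (abs_nonneg _).trans this
      by_cases h1 : x ∈ E j <;> by_cases h2 : x + t ∈ E j <;>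
        simp [ind, Set.mem_symmDiff, h1, h2, this]
    rw [_root_.abs_le, ← hφ.neg hbd]
    exact ⟨hφ.mono hbd.neg ((hb j hft).sub hs) fun x => (_root_.abs_le.1 (hpt x)).1,
      hφ.mono ((hb j hft).sub hs) hbd fun x => (_root_.abs_le.1 (hpt x)).2⟩
  obtain ⟨ψ, hψ, h⟩ := exists_mean_of_ultrafilter U (fun j f => φ fun x => f x * ind (E j) x)
    (fun j f g hf hg => by rw [← hφ.add (hb j hf) (hb j hg)]; simp only [add_mul])
    (fun j c f hf => by rw [← hφ.smul c (hb j hf)]; simp only [mul_assoc])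
    (fun j f hf h0 => hφ.nonneg (hb j hf) fun x => mul_nonneg (h0 x) (SumsetMeans.ind_nonneg _ _))
    (fun j => by simpa using hφ.ind_le_one (E j)) hm (by simpa using hE) hshift
  refine ⟨ψ, hψ, fun X => (h (Bdd.ind X)).congr fun j => ?_⟩
  congr 1; funext x; exact (ind_inter _ _ x).symm

/-- Removing an asymptotically invariant increasing sequence of sets which is null for all relevant
ergodic means. -/
lemma exists_limits {A B C : Set G} {E : ℕ → Set G} (hmono : Monotone E)
    (hinv : ∀ t, Tendsto (fun j => φ (ind (symmDiff (E j) ((fun x => x + t) ⁻¹' E j)))) atTop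
      (nhds 0)) {r δ : ℝ} (hδ : 0 < δ) (hφδ : δ ≤ φ (ind A) + φ (ind B) - φ (ind C))
    (hψ : ∀ ψ : (G → ℝ) → ℝ, IsErgodic ψ → ψ (ind A) + ψ (ind B) - ψ (ind C) ≤ r ∧
      (0 < ψ (ind A) + ψ (ind B) - ψ (ind C) → ∀ k, ψ (ind (E k)) = 0)) :
    ∃ c a b d : ℝ, 0 < c ∧ c ≤ 1 ∧ δ ≤ c * r ∧ δ ≤ a + b - d ∧
      Tendsto (fun j => φ (ind (E j)ᶜ)) atTop (nhds c) ∧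
      Tendsto (fun j => φ (ind (A \ E j))) atTop (nhds a) ∧
      Tendsto (fun j => φ (ind (B \ E j))) atTop (nhds b) ∧
      Tendsto (fun j => φ (ind (C \ E j))) atTop (nhds d) := by
  have hex : ∀ X : Set G, ∃ l, Tendsto (fun j => φ (ind (X \ E j))) atTop (nhds l) := fun X =>
    ⟨_, tendsto_atTop_ciInf (fun i j hij => hφ.ind_mono (Set.sdiff_subset_sdiff_right (hmono hij)))
      ⟨0, by rintro _ ⟨j, rfl⟩; exact hφ.ind_nonneg _⟩⟩
  choose l hl using hex
  have hl0 : ∀ X, 0 ≤ l X := fun X =>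
    ge_of_tendsto (hl X) (Filter.Eventually.of_forall fun j => hφ.ind_nonneg _)
  have hin : ∀ X, Tendsto (fun j => φ (ind (X ∩ E j))) atTop (nhds (φ (ind X) - l X)) := by
    intro X
    refine ((tendsto_const_nhds (x := φ (ind X))).sub (hl X)).congr fun j => ?_
    have := hφ.ind_diff_add_inter X (E j)
    linarith
  have hin0 : ∀ X, 0 ≤ φ (ind X) - l X := fun X =>
    ge_of_tendsto (hin X) (Filter.Eventually.of_forall fun j => hφ.ind_nonneg _)
  have hle : ∀ X, l X ≤ l Set.univ := fun X => le_of_tendsto_of_tendsto' (hl X) (hl _) fun j =>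
    hφ.ind_mono (Set.sdiff_subset_sdiff_left (Set.subset_univ X))
  have hinle : ∀ X, φ (ind X) - l X ≤ 1 - l Set.univ := fun X => by
    rw [← hφ.one, ← ind_univ]
    exact le_of_tendsto_of_tendsto' (hin X) (hin _) fun j =>
      hφ.ind_mono (Set.inter_subset_inter_left _ (Set.subset_univ X))
  have hE : Tendsto (fun j => φ (ind (E j))) atTop (nhds (1 - l Set.univ)) := by
    simpa [ind_univ, hφ.one] using hin Set.univ
  have hU : (hyperfilter ℕ : Filter ℕ) ≤ atTop := Nat.hyperfilter_le_atTop
  have hI : φ (ind A) - l A + (φ (ind B) - l B) - (φ (ind C) - l C) ≤ 0 := by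
    rcases (show (0 : ℝ) ≤ 1 - l Set.univ from (hin0 A).trans (hinle A)).eq_or_lt with hm | hm
    · have h1 := hinle A
      have h2 := hinle B
      have h3 := hin0 C
      linarith
    · obtain ⟨ψ, hψm, hlim⟩ := hφ.exists_restrict (hyperfilter ℕ) E hm (hE.mono_left hU)
        fun t => (hinv t).mono_left hU
      have hX : ∀ X, (1 - l Set.univ) * ψ (ind X) = φ (ind X) - l X := fun X =>
        tendsto_nhds_unique (hlim X) ((hin X).mono_left hU)
      have hk : ∀ k, (1 - l Set.univ) * ψ (ind (E k)) = φ (ind (E k)) := by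
        intro k
        refine tendsto_nhds_unique (hlim _) (Tendsto.mono_left ?_ hU)
        refine tendsto_const_nhds.congr' ?_
        filter_upwards [eventually_ge_atTop k] with j hj
        rw [Set.inter_eq_left.2 (hmono hj)]
      have hsum : ∀ {χ : (G → ℝ) → ℝ} (_ : IsMean χ) (k : ℕ),
          χ (fun x => ind A x + ind B x - ind C x + 2 * ind (E k) x) =
            χ (ind A) + χ (ind B) - χ (ind C) + 2 * χ (ind (E k)) := by
        intro χ hχ k
        have hA := Bdd.ind A
        have hB := Bdd.ind B
        rw [hχ.add ((hA.add hB).sub (Bdd.ind C)) ((Bdd.const 2).mul (Bdd.ind _)),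
          hχ.sub (hA.add hB) (Bdd.ind C), hχ.add hA hB, hχ.smul 2 (Bdd.ind _)]
      have hb : ∀ k, φ (ind A) - l A + (φ (ind B) - l B) - (φ (ind C) - l C) ≤
          2 * (1 - l Set.univ - φ (ind (E k))) := by
        intro k
        have h1 : ψ (fun x => ind A x + ind B x - ind C x + 2 * ind (E k) x) ≤ 2 := by
          refine hψm.le_of_ergodic fun χ hχ => ?_
          rw [hsum hχ.isMean]
          have h2 := hχ.isMean.ind_le_one (E k)
          rcases le_or_gt (χ (ind A) + χ (ind B) - χ (ind C)) 0 with h | h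
          · linarith
          · have h3 := hχ.isMean.ind_le_one A
            have h4 := hχ.isMean.ind_le_one B
            have h5 := hχ.isMean.ind_nonneg C
            have h6 := (hψ χ hχ).2 h k
            linarith
        rw [hsum hψm] at h1
        rw [← hX, ← hX, ← hX, ← hk]
        nlinarith
      have hlim0 := ((tendsto_const_nhds (x := 1 - l Set.univ)).sub hE).const_mul (2 : ℝ)
      rw [sub_self, mul_zero] at hlim0
      exact ge_of_tendsto' hlim0 hb
  have hout : δ ≤ l A + l B - l C := by linarith
  have hc : 0 < l Set.univ := by
    have h1 := hle A
    have h2 := hle B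
    have h3 := hl0 C
    linarith
  have hlc : Tendsto (fun j => φ (ind (E j)ᶜ)) atTop (nhds (l Set.univ)) := by
    simpa only [Set.compl_eq_univ_sdiff] using hl Set.univ
  refine ⟨l Set.univ, l A, l B, l C, hc, ?_, ?_, hout, hlc, hl A, hl B, hl C⟩
  · have := (hin0 A).trans (hinle A)
    linarith
  · obtain ⟨ψ, hψm, hlim⟩ := hφ.exists_restrict (hyperfilter ℕ) (fun j => (E j)ᶜ) hc
      (hlc.mono_left hU) fun t => by
        simpa only [Set.preimage_compl, compl_symmDiff_compl] using (hinv t).mono_left hU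
    have hX : ∀ X, l Set.univ * ψ (ind X) = l X := fun X =>
      tendsto_nhds_unique (hlim X) (by simpa only [Set.sdiff_eq] using (hl X).mono_left hU)
    have hsum : ∀ {χ : (G → ℝ) → ℝ} (_ : IsMean χ),
        χ (fun x => ind A x + ind B x - ind C x) = χ (ind A) + χ (ind B) - χ (ind C) := by
      intro χ hχ
      have hA := Bdd.ind A
      have hB := Bdd.ind B
      rw [hχ.sub (hA.add hB) (Bdd.ind C), hχ.add hA hB]
    have h1 : ψ (fun x => ind A x + ind B x - ind C x) ≤ r := by
      refine hψm.le_of_ergodic fun χ hχ => ?_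
      rw [hsum hχ.isMean]
      exact (hψ χ hχ).1
    rw [hsum hψm] at h1
    rw [← hX A, ← hX B, ← hX C] at hout
    nlinarith

end IsMean

/-- An increasing exhaustion of a countable group by finite sets. -/
lemma exists_exhaustion (G : Type*) [AddCommGroup G] [Countable G] :
    ∃ V : ℕ → Set G, Monotone V ∧ (∀ k, (V k).Finite) ∧ (∀ k, 0 ∈ V k) ∧
      ∀ W : Set G, W.Finite → ∃ k, W ⊆ V k := by
  obtain ⟨f, hf⟩ := exists_surjective_nat G
  have hmono : Monotone fun k => insert (0 : G) (f '' Set.Iio k) := fun i j hij =>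
    Set.insert_subset_insert (Set.image_mono (Set.Iio_subset_Iio hij))
  refine ⟨fun k => insert 0 (f '' Set.Iio k), hmono,
    fun k => ((Set.finite_Iio k).image f).insert 0, fun k => Set.mem_insert _ _, fun W hW => ?_⟩
  induction W, hW using Set.Finite.induction_on with
  | empty => exact ⟨0, Set.empty_subset _⟩
  | @insert a s _ _ ih =>
    obtain ⟨k, hk⟩ := ih
    obtain ⟨n, rfl⟩ := hf a
    refine ⟨max k (n + 1), Set.insert_subset (Or.inr ⟨n, ?_, rfl⟩)
      (hk.trans (hmono (le_max_left _ _)))⟩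
    exact lt_of_lt_of_le (Nat.lt_succ_self n) (le_max_right _ _)

/-- The union of the translates `S - v`, `v ∈ V`. -/
def thicken (S V : Set G) : Set G := ⋃ v ∈ V, (fun x => x + v) ⁻¹' S

namespace IsMean

variable {φ : (G → ℝ) → ℝ} (hφ : IsMean φ)
include hφ

lemma thicken_null {S V : Set G} (hV : V.Finite) (hS : φ (ind S) = 0) :
    φ (ind (thicken S V)) = 0 :=
  hφ.ind_biUnion_null V hV fun v _ => by rw [hφ.ind_preimage_add, hS]

lemma thicken_invariant (S : Set G) {V : ℕ → Set G} (hmono : Monotone V)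
    (hfin : ∀ k, (V k).Finite) (hex : ∀ W : Set G, W.Finite → ∃ k, W ⊆ V k) (t : G) :
    Tendsto (fun j => φ (ind (symmDiff (thicken S (V j))
      ((fun x => x + t) ⁻¹' thicken S (V j))))) atTop (nhds 0) := by
  have hEm : Monotone fun j => thicken S (V j) := fun i j hij =>
    Set.biUnion_subset_biUnion_left (hmono hij)
  have hbdd : BddAbove (Set.range fun j => φ (ind (thicken S (V j)))) :=
    ⟨1, by rintro _ ⟨j, rfl⟩; exact hφ.ind_le_one _⟩
  have hlim := tendsto_atTop_ciSup (fun i j hij => hφ.ind_mono (hEm hij)) hbdd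
  set m := ⨆ j, φ (ind (thicken S (V j))) with hm
  refine squeeze_zero (g := fun j => 2 * (m - φ (ind (thicken S (V j)))))
    (fun j => hφ.ind_nonneg _) (fun j => ?_)
    (by simpa using ((tendsto_const_nhds (x := m)).sub hlim).const_mul (2 : ℝ))
  obtain ⟨k, hk⟩ := hex (V j ∪ (fun v => t + v) '' V j) ((hfin j).union ((hfin j).image _))
  set E := thicken S (V j) with hE
  set E' := (fun x => x + t) ⁻¹' E with hE'
  have h1 : E ∪ E' ⊆ thicken S (V k) := by
    refine Set.union_subset (Set.biUnion_subset_biUnion_left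
      (Set.subset_union_left.trans hk)) fun x hx => ?_
    obtain ⟨v, hv, hx⟩ := Set.mem_iUnion₂.1 (show x + t ∈ E from hx)
    refine Set.mem_biUnion (hk (Or.inr ⟨v, hv, rfl⟩)) ?_
    simpa [add_assoc] using hx
  have h2 : φ (ind (E ∪ E')) ≤ m := (hφ.ind_mono h1).trans (le_ciSup hbdd k)
  have h3 : φ (ind E') = φ (ind E) := hφ.ind_preimage_add E t
  have h4 := hφ.ind_diff_of_subset (Set.subset_union_left : E ⊆ E ∪ E')
  have h5 := hφ.ind_diff_of_subset (Set.subset_union_right : E' ⊆ E ∪ E')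
  rw [Set.union_sdiff_left] at h4
  rw [Set.union_sdiff_right] at h5
  have h6 := hφ.ind_union_le (E \ E') (E' \ E)
  rw [Set.symmDiff_def]
  linarith

end IsMean

end Limits

section Averages

variable {G : Type*}

/-- The average of a function over a finite set. -/
noncomputable def avg (F : Finset G) (f : G → ℝ) : ℝ := (∑ x ∈ F, f x) / F.card

lemma sum_ind (F : Finset G) (X : Set G) : ∑ x ∈ F, ind X x = ((X ∩ (F : Set G)).ncard : ℝ) := by
  classical
  have : X ∩ (F : Set G) = ((F.filter (· ∈ X) : Finset G) : Set G) := by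
    ext x; simp [and_comm]
  rw [this, Set.ncard_coe_finset]
  simp [ind, Set.indicator_apply]

lemma dens_eq_avg (F : ℕ → Finset G) (X : Set G) (n : ℕ) :
    dens G F X n = avg (F n) (ind X) := by
  rw [dens, avg, sum_ind]

lemma dens_nonneg (F : ℕ → Finset G) (X : Set G) (n : ℕ) : 0 ≤ dens G F X n := by
  unfold dens; positivity

lemma dens_le_one (F : ℕ → Finset G) (X : Set G) (n : ℕ) : dens G F X n ≤ 1 := by
  refine div_le_one_of_le₀ ?_ (by positivity)
  rw [← Set.ncard_coe_finset]
  exact_mod_cast Set.ncard_le_ncard Set.inter_subset_right (Finset.finite_toSet _)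

variable [AddCommGroup G]

lemma abs_avg_shift_sub_le (F : Finset G) {f : G → ℝ} {C : ℝ} (hC : ∀ x, |f x| ≤ C) (t : G) :
    |avg F (fun x => f (x + t)) - avg F f| ≤
      C * (((symmDiff (F : Set G) ((F : Set G) + ({t} : Set G))).ncard : ℝ) / F.card) := by
  classical
  set F' := F.map (addRightEmbedding t) with hF'
  have h1 : (F : Set G) + ({t} : Set G) = (F' : Set G) := by simp [hF']
  have h2 : ∑ x ∈ F, f (x + t) = ∑ x ∈ F', f x := by simp [hF']
  rw [avg, avg, h2, ← sub_div, abs_div, Nat.abs_cast, ← mul_div_assoc, h1, ← Finset.coe_symmDiff,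
    Set.ncard_coe_finset]
  refine div_le_div_of_nonneg_right ?_ (by positivity)
  rw [← Finset.sum_sdiff_sub_sum_sdiff]
  have hb : ∀ T : Finset G, |∑ x ∈ T, f x| ≤ C * T.card := fun T => by
    refine (Finset.abs_sum_le_sum_abs _ _).trans ?_
    refine (Finset.sum_le_card_nsmul T _ C fun x _ => hC x).trans_eq ?_
    rw [nsmul_eq_mul, mul_comm]
  have hcard : ((symmDiff F F').card : ℝ) = (F' \ F).card + (F \ F').card := by
    rw [symmDiff_def, Finset.sup_eq_union, Finset.card_union_of_disjoint disjoint_sdiff_sdiff]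
    push_cast; ring
  rw [hcard, mul_add]
  exact (abs_sub _ _).trans (add_le_add (hb _) (hb _))

lemma exists_mean_of_folner {Φ : ℕ → Finset G} (hΦ : IsFolnerSeq G Φ) (U : Ultrafilter ℕ)
    (hU : (U : Filter ℕ) ≤ atTop) : ∃ φ : (G → ℝ) → ℝ, IsMean φ ∧
      ∀ X : Set G, Tendsto (fun n => avg (Φ n) (ind X)) U (nhds (φ (ind X))) := by
  have hpos : ∀ n, (0 : ℝ) < (Φ n).card := fun n => by exact_mod_cast (hΦ.1 n).card_pos
  have hone : ∀ n, avg (Φ n) (fun _ => 1) = 1 := fun n => by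
    simp [avg, (hpos n).ne']
  obtain ⟨φ, hφ, h⟩ := exists_mean_of_ultrafilter U (fun n f => avg (Φ n) f)
    (fun n f g _ _ => by simp only [avg]; rw [Finset.sum_add_distrib, add_div])
    (fun n c f _ => by simp only [avg]; rw [← Finset.mul_sum, mul_div_assoc])
    (fun n f _ h0 => div_nonneg (Finset.sum_nonneg fun x _ => h0 x) (by positivity))
    (fun n => (hone n).le) one_pos (by simp only [hone]; exact tendsto_const_nhds)
    (fun t f ⟨C, hC⟩ => squeeze_zero_norm (fun n => abs_avg_shift_sub_le (Φ n) hC t)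
      (by simpa using ((hΦ.2 t).mono_left hU).const_mul C))
  exact ⟨φ, hφ, fun X => by simpa using h (Bdd.ind X)⟩

lemma exists_ultrafilter_liminf {u : ℕ → ℝ} (h0 : ∀ n, 0 ≤ u n) (h1 : ∀ n, u n ≤ 1) :
    ∃ U : Ultrafilter ℕ, (U : Filter ℕ) ≤ atTop ∧ Tendsto u U (nhds (liminf u atTop)) := by
  refine mapClusterPt_iff_ultrafilter.1 ?_
  rw [((nhds_basis_Ioo_pos (liminf u atTop))).mapClusterPt_iff_frequently]
  intro ε hε
  have hb : IsBoundedUnder (· ≥ ·) atTop u := isBoundedUnder_of ⟨0, h0⟩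
  have hc : IsCoboundedUnder (· ≥ ·) atTop u :=
    IsBoundedUnder.isCoboundedUnder_ge (isBoundedUnder_of ⟨1, h1⟩)
  have e1 := frequently_lt_of_liminf_lt hc (lt_add_of_pos_right (liminf u atTop) hε)
  have e2 := eventually_lt_of_lt_liminf (sub_lt_self (liminf u atTop) hε) hb
  exact (e1.and_eventually e2).mono fun n hn => ⟨hn.2, hn.1⟩

lemma liminf_le_of_ultrafilter {u : ℕ → ℝ} (h0 : ∀ n, 0 ≤ u n) {U : Ultrafilter ℕ}
    (hU : (U : Filter ℕ) ≤ atTop) {l : ℝ} (hl : Tendsto u U (nhds l)) : liminf u atTop ≤ l := by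
  refine le_of_forall_lt_imp_le_of_dense fun c hc => ?_
  exact ge_of_tendsto hl (((eventually_lt_of_lt_liminf hc (isBoundedUnder_of ⟨0, h0⟩)).filter_mono
    hU).mono fun n hn => hn.le)

lemma symmDiff_sdiff_subset (F E : Set G) (t : G) :
    symmDiff (F \ E) (F \ E + ({t} : Set G)) ⊆
      symmDiff F (F + ({t} : Set G)) ∪ symmDiff E ((fun x => x + -t) ⁻¹' E) ∩ F := by
  intro y hy
  simp only [Set.add_singleton, Set.image_add_right, Set.mem_symmDiff, Set.mem_preimage,
    Set.mem_sdiff, Set.mem_union, Set.mem_inter_iff] at hy ⊢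
  tauto

end Averages

section Main

variable {G : Type*}

/-- Finite approximation of the limits of `exists_limits` along the given sequence. -/
lemma exists_approx {Φ : ℕ → Finset G} {U : Ultrafilter ℕ} (hU : (U : Filter ℕ) ≤ atTop)
    {φ : (G → ℝ) → ℝ} (hφ : ∀ X : Set G, Tendsto (fun n => avg (Φ n) (ind X)) U (nhds (φ (ind X))))
    {E : ℕ → Set G} (hE : ∀ j, 0 < φ (ind (E j)ᶜ)) (W : ℕ → Set (Set G))
    (hW : ∀ j, (W j).Finite) :
    ∃ n : ℕ → ℕ, StrictMono n ∧ (∀ j, 0 < avg (Φ (n j)) (ind (E j)ᶜ)) ∧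
      ∀ j, ∀ X ∈ W j, |avg (Φ (n j)) (ind X) - φ (ind X)| < 1 / ((j : ℝ) + 1) := by
  have h : ∀ j, ∃ᶠ n in atTop, 0 < avg (Φ n) (ind (E j)ᶜ) ∧
      ∀ X ∈ W j, |avg (Φ n) (ind X) - φ (ind X)| < 1 / ((j : ℝ) + 1) := by
    intro j
    refine Frequently.filter_mono (f := (U : Filter ℕ)) (Eventually.frequently ?_) hU
    refine ((hφ _).eventually (lt_mem_nhds (hE j))).and ?_
    rw [Filter.eventually_all_finite (hW j)]
    intro X _
    have := (hφ X).eventually (Metric.ball_mem_nhds _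
      (show (0 : ℝ) < 1 / ((j : ℝ) + 1) by positivity))
    simpa only [Metric.mem_ball, Real.dist_eq] using this
  obtain ⟨n, hn, hn'⟩ := extraction_forall_of_frequently h
  exact ⟨n, hn, fun j => (hn' j).1, fun j => (hn' j).2⟩

lemma tendsto_of_approx {u v : ℕ → ℝ} {l : ℝ} (hv : Tendsto v atTop (nhds l))
    (h : ∀ᶠ j : ℕ in atTop, |u j - v j| < 1 / ((j : ℝ) + 1)) : Tendsto u atTop (nhds l) := by
  have : Tendsto (fun j => u j - v j) atTop (nhds 0) :=
    squeeze_zero_norm' (h.mono fun j hj => hj.le) tendsto_one_div_add_atTop_nhds_zero_nat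
  simpa using this.add hv

lemma avg_compl (F : Finset G) (E : Set G) [DecidablePred (· ∉ E)] :
    avg F (ind Eᶜ) = (F.filter (· ∉ E)).card / F.card := by
  rw [avg, sum_ind]
  congr 2
  rw [← Set.ncard_coe_finset]
  congr 1
  ext x; simp [and_comm]

end Main

theorem kneser_folner_seq (A B : Set Γ) (hA : A.Nonempty) (hB : B.Nonempty) :
    ∃ K : AddSubgroup Γ, K.FiniteIndex ∧
      ∀ Φ : ℕ → Finset Γ, IsFolnerSeq Γ Φ →
        ∀ δ : ℝ,
          δ = liminf (dens Γ Φ A) atTop + liminf (dens Γ Φ B) atTop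
              - liminf (dens Γ Φ (A + B)) atTop →
          0 < δ →
          ∃ n : ℕ → ℕ, StrictMono n ∧
            ∃ Ψ : ℕ → Finset Γ, (∀ j, Ψ j ⊆ Φ (n j)) ∧ IsFolnerSeq Γ Ψ ∧
              (K.index : ℝ) * δ ≤
                liminf (fun j => ((Ψ j).card : ℝ) / ((Φ (n j)).card : ℝ)) atTop ∧
              (∃ d : ℝ, Tendsto (dens Γ Ψ (A + B)) atTop (nhds d) ∧
                Tendsto (dens Γ Ψ (A + B + (K : Set Γ))) atTop (nhds d)) ∧
              (∃ dA dB dAB : ℝ, Tendsto (dens Γ Ψ A) atTop (nhds dA) ∧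
                Tendsto (dens Γ Ψ B) atTop (nhds dB) ∧
                Tendsto (dens Γ Ψ (A + B)) atTop (nhds dAB) ∧
                δ ≤ dA + dB - dAB) := by
  classical
  obtain ⟨K, hK, hKψ⟩ := exists_uniform_subgroup hA hB
  refine ⟨K, hK, fun Φ hΦ δ hδe hδ => ?_⟩
  obtain ⟨U, hU, hlimU⟩ := exists_ultrafilter_liminf (dens_nonneg Φ (A + B)) (dens_le_one Φ (A + B))
  obtain ⟨φ, hφ, hφU⟩ := exists_mean_of_folner hΦ U hU
  have hφdens : ∀ X : Set Γ, Tendsto (dens Γ Φ X) U (nhds (φ (ind X))) := fun X =>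
    (hφU X).congr fun n => (dens_eq_avg Φ X n).symm
  have hφδ : δ ≤ φ (ind A) + φ (ind B) - φ (ind (A + B)) := by
    have h1 := liminf_le_of_ultrafilter (dens_nonneg Φ A) hU (hφdens A)
    have h2 := liminf_le_of_ultrafilter (dens_nonneg Φ B) hU (hφdens B)
    have h3 := tendsto_nhds_unique (hφdens (A + B)) hlimU
    linarith
  obtain ⟨V, hVm, hVf, hV0, hVe⟩ := exists_exhaustion Γ
  set S := (A + B + (K : Set Γ)) \ (A + B) with hS
  set E : ℕ → Set Γ := fun j => thicken S (V j) with hE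
  have hEm : Monotone E := fun i j hij => Set.biUnion_subset_biUnion_left (hVm hij)
  have hSE : ∀ j, S ⊆ E j := fun j x hx => Set.mem_biUnion (hV0 j) (by simpa using hx)
  have hinv := hφ.thicken_invariant S hVm hVf hVe
  obtain ⟨c, a, b, d, hc0, hc1, hcδ, hδabd, hlc, hla, hlb, hld⟩ :=
    hφ.exists_limits hEm hinv hδ hφδ fun ψ hψ =>
      ⟨(hKψ ψ hψ).1, fun h k => hψ.isMean.thicken_null (hVf k) ((hKψ ψ hψ).2 h)⟩
  have hanti : Antitone fun j => φ (ind (E j)ᶜ) := fun i j hij =>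
    hφ.ind_mono (Set.compl_subset_compl.2 (hEm hij))
  have hEpos : ∀ j, 0 < φ (ind (E j)ᶜ) := fun j => hc0.trans_le (hanti.le_of_tendsto hlc j)
  obtain ⟨n, hn, hnpos, hnW⟩ := exists_approx hU hφU hEpos
    (fun j => {(E j)ᶜ, A \ E j, B \ E j, (A + B) \ E j} ∪
      (fun t => symmDiff (E j) ((fun x => x + t) ⁻¹' E j)) '' V j)
    (fun j => (Set.toFinite _).union ((hVf j).image _))
  let Ψ : ℕ → Finset Γ := fun j => (Φ (n j)).filter (· ∉ E j)
  have hΨ : ∀ j, (Ψ j : Set Γ) = (Φ (n j) : Set Γ) \ E j := fun j => by ext x; simp [Ψ]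
  have hΦpos : ∀ j, (0 : ℝ) < (Φ j).card := fun j => by exact_mod_cast (hΦ.1 j).card_pos
  have hratio : ∀ j, avg (Φ (n j)) (ind (E j)ᶜ) = (Ψ j).card / (Φ (n j)).card := fun j =>
    avg_compl _ _
  have hΨpos : ∀ j, (0 : ℝ) < (Ψ j).card := fun j => by
    have h1 := hnpos j
    rw [hratio] at h1
    exact (div_pos_iff_of_pos_right (hΦpos _)).1 h1
  have hlimc : Tendsto (fun j => ((Ψ j).card : ℝ) / (Φ (n j)).card) atTop (nhds c) :=
    tendsto_of_approx hlc (Eventually.of_forall fun j => by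
      rw [← hratio]; exact hnW j _ (by simp))
  have hdens : ∀ (X : Set Γ) {l : ℝ}, Tendsto (fun j => φ (ind (X \ E j))) atTop (nhds l) →
      (∀ j, |avg (Φ (n j)) (ind (X \ E j)) - φ (ind (X \ E j))| < 1 / ((j : ℝ) + 1)) →
      Tendsto (dens Γ Ψ X) atTop (nhds (l / c)) := by
    intro X l hl hX
    refine ((tendsto_of_approx hl (Eventually.of_forall hX)).div hlimc hc0.ne').congr fun j => ?_
    simp only [Pi.div_apply]
    rw [avg, sum_ind, dens, hΨ, div_div_div_cancel_right₀ (hΦpos _).ne', ← Set.inter_sdiff_assoc,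
      Set.inter_sdiff_right_comm]
  have hdA := hdens A hla fun j => hnW j _ (by simp)
  have hdB := hdens B hlb fun j => hnW j _ (by simp)
  have hdC := hdens (A + B) hld fun j => hnW j _ (by simp)
  refine ⟨n, hn, Ψ, fun j => Finset.filter_subset _ _, ⟨fun j => ?_, fun t => ?_⟩, ?_,
    ⟨d / c, hdC, hdC.congr fun j => ?_⟩, ⟨a / c, b / c, d / c, hdA, hdB, hdC, ?_⟩⟩
  · exact Finset.card_pos.1 (by exact_mod_cast hΨpos j)
  · have hD : Tendsto (fun j => avg (Φ (n j))
        (ind (symmDiff (E j) ((fun x => x + -t) ⁻¹' E j)))) atTop (nhds 0) := by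
      refine tendsto_of_approx (hinv (-t)) ?_
      obtain ⟨k, hk⟩ := hVe {-t} (Set.finite_singleton _)
      filter_upwards [eventually_ge_atTop k] with j hj
      exact hnW j _ (Or.inr ⟨-t, hVm hj (hk rfl), rfl⟩)
    have hsum := (((hΦ.2 t).comp hn.tendsto_atTop).add hD).div hlimc hc0.ne'
    rw [add_zero, zero_div] at hsum
    refine squeeze_zero (fun j => by positivity) (fun j => ?_) hsum
    simp only [Pi.div_apply, Function.comp_apply]
    rw [avg, sum_ind, ← add_div, div_div_div_cancel_right₀ (hΦpos _).ne', hΨ]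
    refine div_le_div_of_nonneg_right ?_ (hΨpos j).le
    have hfin : (symmDiff (Φ (n j) : Set Γ) ((Φ (n j) : Set Γ) + ({t} : Set Γ))).Finite :=
      (Finset.finite_toSet _).symmDiff ((Finset.finite_toSet _).add (Set.finite_singleton t))
    have h1 := Set.ncard_le_ncard (symmDiff_sdiff_subset (Φ (n j) : Set Γ) (E j) t)
      (hfin.union ((Finset.finite_toSet _).inter_of_right _))
    exact_mod_cast h1.trans (Set.ncard_union_le _ _)
  · rw [hlimc.liminf_eq]
    have hi : (0 : ℝ) < K.index := by
      exact_mod_cast Nat.pos_of_ne_zero AddSubgroup.FiniteIndex.index_ne_zero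
    rw [mul_one_div, le_div_iff₀ hi] at hcδ
    linarith
  · rw [dens, dens]
    congr 3
    ext x
    rw [Set.mem_inter_iff, Set.mem_inter_iff]
    refine and_congr_left fun hx => ⟨fun h => subset_add_subgroup _ K h, fun h => ?_⟩
    by_contra hx'
    rw [hΨ] at hx
    exact hx.2 (hSE j ⟨h, hx'⟩)
  · rw [← add_div, ← sub_div, le_div_iff₀ hc0]
    nlinarith

end SumsetMeans
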